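/- Let X and Y be m × n matrices of distinct indeterminates over a field K, H = (X Y) their m × 2n horizontal concatenation, and V their 2m × n vertical concatenation. Let J = I_m(H) + I_n(V) be the ideal of R = K[x_{ij}, y_{ij}] generated by the maximal minors of H and the maximal minors of V. Then with respect to any diagonal term order, the natural generators (the m-minors of H and the n-minors of V) form a Gröbner basis of J. -/

import Mathlib

/-! Statement 7: for two generic m × n matrices X, Y, the m-minors of the
horizontal concatenation H = (X Y) and the n-minors of the vertical
concatenation V form a Gröbner basis of J = I_m(H) + I_n(V) under any
diagonal term order. (Here r = 2 in the general setup.) -/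

open MvPolynomial

noncomputable section

/-- A term order on monomials (exponent vectors) in variables indexed by `σ`. -/
structure TermOrder (σ : Type*) where
  lt : (σ →₀ ℕ) → (σ →₀ ℕ) → Prop
  trans : ∀ {a b c}, lt a b → lt b c → lt a c
  irrefl : ∀ a, ¬ lt a a
  total : ∀ a b, a ≠ b → lt a b ∨ lt b a
  zero_lt : ∀ a, a ≠ 0 → lt 0 a
  add_right : ∀ a b c, lt a b → lt (a + c) (b + c)

/-- `m` is the leading monomial of `f` with respect to the term order `tord`. -/
def IsLeadMono {σ K : Type*} [Field K] (tord : TermOrder σ) (f : MvPolynomial σ K)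
    (m : σ →₀ ℕ) : Prop :=
  m ∈ f.support ∧ ∀ m' ∈ f.support, m' ≠ m → tord.lt m' m

/-- The initial ideal of `I` with respect to the term order `tord`. -/
def initialIdeal {σ K : Type*} [Field K] (tord : TermOrder σ) (I : Ideal (MvPolynomial σ K)) :
    Ideal (MvPolynomial σ K) :=
  Ideal.span {g | ∃ f ∈ I, ∃ m, IsLeadMono tord f m ∧ g = monomial m (1 : K)}

/-- `G` is a Gröbner basis of `I` with respect to `tord`. -/
def IsGroebnerBasis {σ K : Type*} [Field K] (tord : TermOrder σ)
    (I : Ideal (MvPolynomial σ K)) (G : Set (MvPolynomial σ K)) : Prop :=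
  G ⊆ (I : Set (MvPolynomial σ K)) ∧ Ideal.span G = I ∧
    initialIdeal tord I = Ideal.span {g | ∃ f ∈ G, ∃ m, IsLeadMono tord f m ∧ g = monomial m (1 : K)}

/-- The set of `t × t` minors of a matrix. -/
def minorsSet {A : Type*} [CommRing A] (t a b : ℕ) (M : Matrix (Fin a) (Fin b) A) : Set A :=
  {d | ∃ (rs : Fin t → Fin a) (cs : Fin t → Fin b),
    StrictMono rs ∧ StrictMono cs ∧ d = (M.submatrix rs cs).det}

/-- The variable in row `i`, column `k` of the horizontal concatenation
`H = (X_1 ⋯ X_r)` of `r` generic `m × n` matrices. -/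
def varH (r m n : ℕ) (hn : 0 < n) (i : Fin m) (k : Fin (r * n)) :
    Fin r × Fin m × Fin n :=
  (⟨k.val / n, by
      have := k.isLt
      exact (Nat.div_lt_iff_lt_mul hn).mpr this⟩, i, ⟨k.val % n, Nat.mod_lt _ hn⟩)

/-- The variable in row `k`, column `j` of the vertical concatenation
`V` of `r` generic `m × n` matrices. -/
def varV (r m n : ℕ) (hm : 0 < m) (k : Fin (r * m)) (j : Fin n) :
    Fin r × Fin m × Fin n :=
  (⟨k.val / m, by
      have := k.isLt
      exact (Nat.div_lt_iff_lt_mul hm).mpr this⟩, ⟨k.val % m, Nat.mod_lt _ hm⟩, j)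

/-- The horizontal concatenation `H` as a matrix of polynomials. -/
def Hmat (K : Type*) [Field K] (r m n : ℕ) (hn : 0 < n) :
    Matrix (Fin m) (Fin (r * n)) (MvPolynomial (Fin r × Fin m × Fin n) K) :=
  Matrix.of fun i k => X (varH r m n hn i k)

/-- The vertical concatenation `V` as a matrix of polynomials. -/
def Vmat (K : Type*) [Field K] (r m n : ℕ) (hm : 0 < m) :
    Matrix (Fin (r * m)) (Fin n) (MvPolynomial (Fin r × Fin m × Fin n) K) :=
  Matrix.of fun k j => X (varV r m n hm k j)

/-- `tord` is a diagonal term order for the matrix of variables `v`: the leading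
monomial of the determinant of every square submatrix (with strictly increasing
rows and columns) is the product of its main diagonal entries. -/
def IsDiagonalFor (K : Type*) [Field K] {σ : Type*} (tord : TermOrder σ) {a b : ℕ}
    (v : Fin a → Fin b → σ) : Prop :=
  ∀ (t : ℕ) (rs : Fin t → Fin a) (cs : Fin t → Fin b), StrictMono rs → StrictMono cs →
    0 < t →
    IsLeadMono tord ((Matrix.of fun i j => (X (v (rs i) (cs j)) : MvPolynomial σ K)).det)
      (∑ i : Fin t, Finsupp.single (v (rs i) (cs i)) 1)

/-- A term order is diagonal for the double determinantal configuration if it is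
diagonal for both the horizontal and the vertical concatenation. -/
def IsDiagonalTermOrder (K : Type*) [Field K] (r m n : ℕ) (hm : 0 < m) (hn : 0 < n)
    (tord : TermOrder (Fin r × Fin m × Fin n)) : Prop :=
  IsDiagonalFor K tord (fun i k => varH r m n hn i k) ∧
    IsDiagonalFor K tord (fun k j => varV r m n hm k j)

/-- The double determinantal ideal `J = I_s(H) + I_t(V)`. -/
def doubleDetIdeal (K : Type*) [Field K] (r m n s t : ℕ) (hm : 0 < m) (hn : 0 < n) :
    Ideal (MvPolynomial (Fin r × Fin m × Fin n) K) :=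
  Ideal.span (minorsSet s m (r * n) (Hmat K r m n hn) ∪ minorsSet t (r * m) n (Vmat K r m n hm))

section OrderLemmas

variable {σ K : Type*} [Field K]

theorem TermOrder.wf_lt [Finite σ] (t : TermOrder σ) : WellFounded t.lt := by
  rw [wellFounded_iff_isEmpty_descending_chain]
  refine ⟨fun ⟨f, hf⟩ => ?_⟩
  have hdesc : ∀ i j, i < j → t.lt (f j) (f i) := by
    intro i j hij
    induction j, hij using Nat.le_induction with
    | base => exact hf i
    | succ k _ ih => exact t.trans (hf k) ih
  obtain ⟨i, j, hij, hle⟩ := wellQuasiOrdered_le (α := σ →₀ ℕ) f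
  have h1 := hdesc i j hij
  obtain ⟨c, hc⟩ := exists_add_of_le hle
  by_cases h0 : c = 0
  · rw [hc, h0, add_zero] at h1
    exact t.irrefl _ h1
  · have := t.add_right _ _ (f i) (t.zero_lt c h0)
    rw [zero_add, add_comm, ← hc] at this
    exact t.irrefl _ (t.trans h1 this)

theorem TermOrder.exists_max (t : TermOrder σ) (s : Finset (σ →₀ ℕ)) (hs : s.Nonempty) :
    ∃ m ∈ s, ∀ m' ∈ s, m' ≠ m → t.lt m' m := by
  classical
  induction hs using Finset.Nonempty.cons_induction with
  | singleton a => exact ⟨a, by simp, by simp⟩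
  | cons a s ha hs ih =>
    obtain ⟨m, hm, hmax⟩ := ih
    have hne : a ≠ m := fun h => ha (h ▸ hm)
    rcases t.total a m hne with h | h
    · refine ⟨m, by simp [hm], fun m' hm' hne' => ?_⟩
      rcases Finset.mem_cons.1 hm' with rfl | h'
      · exact h
      · exact hmax m' h' hne'
    · refine ⟨a, by simp, fun m' hm' hne' => ?_⟩
      rcases Finset.mem_cons.1 hm' with rfl | h'
      · exact absurd rfl hne'
      · by_cases h2 : m' = m
        · exact h2 ▸ h
        · exact t.trans (hmax m' h' h2) h

theorem exists_lead (t : TermOrder σ) (f : MvPolynomial σ K) (hf : f ≠ 0) :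
    ∃ m, IsLeadMono t f m := by
  obtain ⟨m, hm, h⟩ := t.exists_max f.support
    (by rwa [Finset.nonempty_iff_ne_empty, Ne, MvPolynomial.support_eq_empty])
  exact ⟨m, hm, h⟩

theorem lead_shift (t : TermOrder σ) (g : MvPolynomial σ K) (a M : σ →₀ ℕ)
    (hg : IsLeadMono t g a) (haM : a ≤ M) (c : K) :
    ∃ p : MvPolynomial σ K, coeff M (p * g) = c ∧
      ∀ m ∈ (p * g).support, m ≠ M → t.lt m M := by
  obtain ⟨d, rfl⟩ := exists_add_of_le haM
  have hlc : coeff a g ≠ 0 := MvPolynomial.mem_support_iff.1 hg.1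
  refine ⟨monomial d (c / coeff a g), ?_, ?_⟩
  · rw [add_comm a d, coeff_monomial_mul]
    field_simp
  · intro m hm hne
    rw [MvPolynomial.mem_support_iff, coeff_monomial_mul'] at hm
    split_ifs at hm with hd
    · obtain ⟨e, rfl⟩ := exists_add_of_le hd
      have he : e ∈ g.support := by
        rw [MvPolynomial.mem_support_iff]
        intro h0
        apply hm
        rw [add_tsub_cancel_left, h0, mul_zero]
      have hea : e ≠ a := by
        rintro rfl
        exact hne (add_comm _ _)
      have := t.add_right _ _ d (hg.2 e he hea)
      rwa [add_comm e d] at this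
    · exact absurd rfl hm

theorem std_normal_form [Finite σ] (t : TermOrder σ) (P : Ideal (MvPolynomial σ K))
    (L : Set (σ →₀ ℕ)) (hL : ∀ a ∈ L, ∃ g ∈ P, IsLeadMono t g a) (M : σ →₀ ℕ) :
    ∀ f : MvPolynomial σ K, (∀ m ∈ f.support, t.lt m M) →
      ∃ r : MvPolynomial σ K, f - r ∈ P ∧ (∀ m ∈ r.support, t.lt m M) ∧
        (∀ m ∈ r.support, ∀ a ∈ L, ¬ a ≤ m) := by
  classical
  induction M using t.wf_lt.induction with
  | _ M ih =>
  intro f hf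
  by_cases h0 : f = 0
  · exact ⟨0, by simp [h0], by simp, by simp⟩
  obtain ⟨μ, hμ⟩ := exists_lead t f h0
  have key : ∀ q : MvPolynomial σ K, coeff μ q = coeff μ f →
      (∀ m ∈ q.support, m ≠ μ → t.lt m μ) → ∀ m ∈ (f - q).support, t.lt m μ := by
    intro q hq1 hq2 m hm
    have hne : m ≠ μ := by
      rintro rfl
      rw [MvPolynomial.mem_support_iff, coeff_sub, hq1, sub_self] at hm
      exact hm rfl
    rcases Finset.mem_union.1 (MvPolynomial.support_sub σ f q hm) with h | h
    · exact hμ.2 m h hne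
    · exact hq2 m h hne
  by_cases hstd : ∃ a ∈ L, a ≤ μ
  · obtain ⟨a, ha, haμ⟩ := hstd
    obtain ⟨g, hgP, hg⟩ := hL a ha
    obtain ⟨p, hp1, hp2⟩ := lead_shift t g a μ hg haμ (coeff μ f)
    obtain ⟨r, hr1, hr2, hr3⟩ := ih μ (hf μ hμ.1) (f - p * g) (key _ hp1 hp2)
    refine ⟨r, ?_, fun m hm => t.trans (hr2 m hm) (hf μ hμ.1), hr3⟩
    have : f - r = (f - p * g - r) + p * g := by ring
    rw [this]
    exact P.add_mem hr1 (P.mul_mem_left _ hgP)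
  · push Not at hstd
    obtain ⟨r, hr1, hr2, hr3⟩ := ih μ (hf μ hμ.1) (f - monomial μ (coeff μ f))
      (key _ (by simp) (by
        intro m hm hne
        have := MvPolynomial.support_monomial_subset hm
        exact absurd (Finset.mem_singleton.1 this) hne))
    have hsup : ∀ m ∈ (monomial μ (coeff μ f) + r).support, m = μ ∨ m ∈ r.support := by
      intro m hm
      rcases Finset.mem_union.1 (MvPolynomial.support_add hm) with h | h
      · exact Or.inl (Finset.mem_singleton.1 (MvPolynomial.support_monomial_subset h))
      · exact Or.inr h
    refine ⟨monomial μ (coeff μ f) + r, ?_, ?_, ?_⟩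
    · have : f - (monomial μ (coeff μ f) + r) = f - monomial μ (coeff μ f) - r := by ring
      rw [this]
      exact hr1
    · intro m hm
      rcases hsup m hm with rfl | h
      · exact hf _ hμ.1
      · exact t.trans (hr2 m h) (hf μ hμ.1)
    · intro m hm
      rcases hsup m hm with rfl | h
      · exact hstd
      · exact hr3 m h

/-- If no nonzero element of `P` is supported on standard monomials, then lead monomials of `P`
are divisible by elements of `L`. -/
theorem lead_of_std [Finite σ] (t : TermOrder σ) (P : Ideal (MvPolynomial σ K))
    (L : Set (σ →₀ ℕ)) (hL : ∀ a ∈ L, ∃ g ∈ P, IsLeadMono t g a)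
    (hstd : ∀ f ∈ P, (∀ m ∈ f.support, ∀ a ∈ L, ¬ a ≤ m) → f = 0)
    (f : MvPolynomial σ K) (hf : f ∈ P) (μ : σ →₀ ℕ) (hμ : IsLeadMono t f μ) :
    ∃ a ∈ L, a ≤ μ := by
  classical
  by_contra hcon
  push Not at hcon
  obtain ⟨r, hr1, hr2, hr3⟩ := std_normal_form t P L hL μ (f - monomial μ (coeff μ f)) (by
    intro m hm
    have hne : m ≠ μ := by
      rintro rfl
      simp at hm
    refine hμ.2 m ?_ hne
    rw [MvPolynomial.mem_support_iff, coeff_sub, coeff_monomial, if_neg (Ne.symm hne),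
      sub_zero] at hm
    exact MvPolynomial.mem_support_iff.2 hm)
  have hmem : monomial μ (coeff μ f) + r ∈ P := by
    have : monomial μ (coeff μ f) + r = f - (f - monomial μ (coeff μ f) - r) := by ring
    rw [this]
    exact P.sub_mem hf hr1
  have h0 := hstd _ hmem (by
    intro m hm
    rcases Finset.mem_union.1 (MvPolynomial.support_add hm) with h | h
    · rw [Finset.mem_singleton.1 (MvPolynomial.support_monomial_subset h)]
      exact hcon
    · exact hr3 m h)
  have h1 := congrArg (coeff μ) h0
  have h2 : coeff μ r = 0 := by
    by_contra h
    exact t.irrefl _ (hr2 μ (MvPolynomial.mem_support_iff.2 h))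
  rw [coeff_add, h2, coeff_monomial, if_pos rfl, add_zero, coeff_zero] at h1
  exact MvPolynomial.mem_support_iff.1 hμ.1 h1

theorem isLead_unique (t : TermOrder σ) (f : MvPolynomial σ K) (μ ν : σ →₀ ℕ)
    (h1 : IsLeadMono t f μ) (h2 : IsLeadMono t f ν) : μ = ν := by
  by_contra h
  exact t.irrefl _ (t.trans (h1.2 ν h2.1 (Ne.symm h)) (h2.2 μ h1.1 h))

/-- Sum of two ideals with lcm's realised in the intersection. -/
theorem lead_of_sum [Finite σ] (t : TermOrder σ) (P Q : Ideal (MvPolynomial σ K))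
    (LP LQ : Set (σ →₀ ℕ))
    (hP : ∀ f ∈ P, ∀ μ, IsLeadMono t f μ → ∃ a ∈ LP, a ≤ μ)
    (hQ : ∀ f ∈ Q, ∀ μ, IsLeadMono t f μ → ∃ a ∈ LQ, a ≤ μ)
    (hPQ : ∀ a ∈ LP, ∀ b ∈ LQ, ∃ h, h ∈ P ∧ h ∈ Q ∧ IsLeadMono t h (a ⊔ b))
    (F : MvPolynomial σ K) (hF : F ∈ P ⊔ Q) (μ : σ →₀ ℕ) (hμ : IsLeadMono t F μ) :
    ∃ a ∈ LP ∪ LQ, a ≤ μ := by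
  classical
  by_contra hcon
  push Not at hcon
  have main : ∀ M, ∀ f ∈ P, ∀ g ∈ Q, f + g = F → IsLeadMono t f M → False := by
    intro M
    induction M using t.wf_lt.induction with
    | _ M ih =>
    intro f hf g hg hfg hM
    obtain ⟨a, ha, haM⟩ := hP f hf M hM
    by_cases hg0 : g = 0
    · rw [hg0, add_zero] at hfg
      subst hfg
      rw [isLead_unique t _ _ _ hM hμ] at haM
      exact hcon a (Or.inl ha) haM
    obtain ⟨M', hM'⟩ := exists_lead t g hg0
    obtain ⟨b, hb, hbM⟩ := hQ g hg M' hM'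
    have aux : ∀ N N' (f g : MvPolynomial σ K), IsLeadMono t f N → IsLeadMono t g N' →
        t.lt N' N → IsLeadMono t (f + g) N := by
      intro N N' f g hN hN' hlt
      have hle : ∀ m ∈ g.support, t.lt m N := by
        intro m hm
        by_cases h : m = N'
        · exact h ▸ hlt
        · exact t.trans (hN'.2 m hm h) hlt
      refine ⟨?_, ?_⟩
      · rw [MvPolynomial.mem_support_iff, coeff_add]
        have : coeff N g = 0 := by
          by_contra h
          exact t.irrefl _ (hle N (MvPolynomial.mem_support_iff.2 h))
        rw [this, add_zero]
        exact MvPolynomial.mem_support_iff.1 hN.1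
      · intro m hm hne
        rcases Finset.mem_union.1 (MvPolynomial.support_add hm) with h | h
        · exact hN.2 m h hne
        · exact hle m h
    by_cases hMM : M' = M
    · subst hMM
      by_cases hc : coeff M' F = 0
      · obtain ⟨h, hhP, hhQ, hh⟩ := hPQ a ha b hb
        obtain ⟨p, hp1, hp2⟩ := lead_shift t h (a ⊔ b) M' hh (sup_le haM hbM) (coeff M' f)
        by_cases hf0 : f - p * h = 0
        · have hFQ : F ∈ Q := by
            rw [← hfg, sub_eq_zero.1 hf0]
            exact Q.add_mem (Q.mul_mem_left _ hhQ) hg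
          obtain ⟨a', ha', hle⟩ := hQ F hFQ μ hμ
          exact hcon a' (Or.inr ha') hle
        · obtain ⟨N, hN⟩ := exists_lead t _ hf0
          have hNM : N ≠ M' := by
            rintro rfl
            have := MvPolynomial.mem_support_iff.1 hN.1
            rw [coeff_sub, hp1, sub_self] at this
            exact this rfl
          have hlt : t.lt N M' := by
            rcases Finset.mem_union.1 (MvPolynomial.support_sub σ _ _ hN.1) with h' | h'
            · exact hM.2 N h' hNM
            · exact hp2 N h' hNM
          exact ih N hlt (f - p * h) (P.sub_mem hf (P.mul_mem_left _ hhP)) (g + p * h)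
            (Q.add_mem hg (Q.mul_mem_left _ hhQ)) (by rw [← hfg]; ring) hN
      · have : IsLeadMono t F M' := by
          refine ⟨MvPolynomial.mem_support_iff.2 hc, ?_⟩
          intro m hm hne
          rw [← hfg] at hm
          rcases Finset.mem_union.1 (MvPolynomial.support_add hm) with h' | h'
          · exact hM.2 m h' hne
          · exact hM'.2 m h' hne
        rw [isLead_unique t _ _ _ this hμ] at haM
        exact hcon a (Or.inl ha) haM
    · rcases t.total _ _ hMM with hlt | hlt
      · have := aux _ _ f g hM hM' hlt
        rw [hfg] at this
        rw [isLead_unique t _ _ _ this hμ] at haM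
        exact hcon a (Or.inl ha) haM
      · have := aux _ _ g f hM' hM hlt
        rw [add_comm, hfg] at this
        rw [isLead_unique t _ _ _ this hμ] at hbM
        exact hcon b (Or.inr hb) hbM
  obtain ⟨f, hf, g, hg, hfg⟩ := Submodule.mem_sup.1 hF
  by_cases hf0 : f = 0
  · rw [hf0, zero_add] at hfg
    subst hfg
    obtain ⟨a', ha', hle⟩ := hQ _ hg μ hμ
    exact hcon a' (Or.inr ha') hle
  · obtain ⟨M, hM⟩ := exists_lead t f hf0
    exact main M f hf g hg hfg hM

/-- The lexicographic term order given by an injective rank function (small rank = big variable). -/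
def rankLex {α : Type*} [Finite σ] [LinearOrder α] (ρ : σ → α) (hρ : Function.Injective ρ) :
    TermOrder σ where
  lt a b := ∃ s, a s < b s ∧ ∀ s', ρ s' < ρ s → a s' = b s'
  trans := by
    rintro a b c ⟨s, hs, hs'⟩ ⟨u, hu, hu'⟩
    rcases lt_trichotomy (ρ s) (ρ u) with h | h | h
    · exact ⟨s, by rw [← hu' s h]; exact hs,
        fun z hz => (hs' z hz).trans (hu' z (hz.trans h))⟩
    · have := hρ h
      subst this
      exact ⟨s, hs.trans hu, fun z hz => (hs' z hz).trans (hu' z hz)⟩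
    · exact ⟨u, by rw [hs' u h]; exact hu,
        fun z hz => (hs' z (hz.trans h)).trans (hu' z hz)⟩
  irrefl := by
    rintro a ⟨s, hs, -⟩
    exact lt_irrefl _ hs
  total := by
    intro a b hab
    have hne : {s | a s ≠ b s}.Nonempty := by
      by_contra h
      rw [Set.not_nonempty_iff_eq_empty] at h
      apply hab
      ext s
      by_contra h'
      have : s ∈ {s | a s ≠ b s} := h'
      rw [h] at this
      exact this
    obtain ⟨s, hs, hmin⟩ := Set.exists_min_image _ ρ (Set.toFinite _) hne
    have hag : ∀ s', ρ s' < ρ s → a s' = b s' := by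
      intro s' h'
      by_contra h
      exact absurd (hmin s' h) (not_le.2 h')
    rcases lt_or_gt_of_ne hs with h | h
    · exact Or.inl ⟨s, h, hag⟩
    · exact Or.inr ⟨s, h, fun z hz => (hag z hz).symm⟩
  zero_lt := by
    intro a ha
    have hne : {s | a s ≠ 0}.Nonempty := by
      obtain ⟨s, hs⟩ := Finsupp.ne_iff.1 ha
      exact ⟨s, hs⟩
    obtain ⟨s, hs, hmin⟩ := Set.exists_min_image _ ρ (Set.toFinite _) hne
    refine ⟨s, Nat.pos_of_ne_zero hs, fun z hz => ?_⟩
    by_contra h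
    exact absurd (hmin z (fun h' => h h'.symm)) (not_le.2 hz)
  add_right := by
    rintro a b c ⟨s, hs, hs'⟩
    exact ⟨s, by simpa using hs, fun z hz => by simp [hs' z hz]⟩

end OrderLemmas

section MaxMinors

variable {K : Type*} [Field K] {m N : ℕ}

/-- Image of the variable in row `i`, column `c`: the last row is a generic combination. -/
def phiVar (K : Type*) [Field K] (m N : ℕ) (i : Fin (m + 1)) (c : Fin N) :
    MvPolynomial (Fin m ⊕ Fin m × Fin N) K :=
  Fin.lastCases (motive := fun _ => MvPolynomial (Fin m ⊕ Fin m × Fin N) K)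
    (∑ k, X (Sum.inl k) * X (Sum.inr (k, c))) (fun k => X (Sum.inr (k, c))) i

def phiKer (K : Type*) [Field K] (m N : ℕ) (i : Fin (m + 1)) :
    MvPolynomial (Fin m ⊕ Fin m × Fin N) K :=
  Fin.lastCases (motive := fun _ => MvPolynomial (Fin m ⊕ Fin m × Fin N) K)
    (-1) (fun k => X (Sum.inl k)) i

theorem phiKer_sum (c : Fin N) : ∑ i, phiKer K m N i * phiVar K m N i c = 0 := by
  rw [Fin.sum_univ_castSucc]
  simp [phiKer, phiVar]

theorem phiKer_last : phiKer K m N (Fin.last m) = -1 := by simp [phiKer]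

def phiHom (K : Type*) [Field K] (m N : ℕ) :
    MvPolynomial (Fin (m + 1) × Fin N) K →ₐ[K] MvPolynomial (Fin m ⊕ Fin m × Fin N) K :=
  aeval fun p => phiVar K m N p.1 p.2

def nuExp (μ : Fin (m + 1) × Fin N →₀ ℕ) (δ : Fin N → Fin m → ℕ) :
    (Fin m ⊕ Fin m × Fin N) →₀ ℕ :=
  Finsupp.equivFunOnFinite.symm
    (Sum.elim (fun k => ∑ c, δ c k) (fun p => μ (p.1.castSucc, p.2) + δ p.2 p.1))

theorem phiHom_monomial (μ : Fin (m + 1) × Fin N →₀ ℕ) (a : K) :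
    phiHom K m N (monomial μ a) =
      ∑ δ ∈ Fintype.piFinset fun c => Finset.piAntidiag Finset.univ (μ (Fin.last m, c)),
        monomial (nuExp μ δ) (a * ((∏ c, Nat.multinomial Finset.univ (δ c) : ℕ) : K)) := by
  have h1 : phiHom K m N (monomial μ a) = C a * ∏ c : Fin N,
      ∑ d ∈ Finset.piAntidiag Finset.univ (μ (Fin.last m, c)),
        (∏ k : Fin m, X (Sum.inr (k, c)) ^ μ (k.castSucc, c)) *
          ((Nat.multinomial Finset.univ d : MvPolynomial (Fin m ⊕ Fin m × Fin N) K) *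
            ∏ k : Fin m, (X (Sum.inl k) * X (Sum.inr (k, c))) ^ d k) := by
    rw [phiHom, aeval_monomial, Finsupp.prod_fintype _ _ (by simp), Fintype.prod_prod_type_right]
    congr 1
    refine Finset.prod_congr rfl fun c _ => ?_
    rw [Fin.prod_univ_castSucc, ← Finset.mul_sum]
    congr 1
    · simp [phiVar]
    · simp only [phiVar, Fin.lastCases_last]
      rw [Finset.sum_pow_eq_sum_piAntidiag]
  rw [h1, Finset.prod_univ_sum, Finset.mul_sum]
  refine Finset.sum_congr rfl fun δ _ => ?_
  rw [Finset.prod_mul_distrib, Finset.prod_mul_distrib]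
  have h2 : (monomial (nuExp μ δ) (a * ((∏ c, Nat.multinomial Finset.univ (δ c) : ℕ) : K)) :
      MvPolynomial (Fin m ⊕ Fin m × Fin N) K) =
      C (a * ((∏ c, Nat.multinomial Finset.univ (δ c) : ℕ) : K)) *
        ((∏ k, X (Sum.inl k) ^ (∑ c, δ c k)) *
          ∏ c, ∏ k, X (Sum.inr (k, c)) ^ (μ (k.castSucc, c) + δ c k)) := by
    rw [monomial_eq, Finsupp.prod_fintype _ _ (by simp), Fintype.prod_sum_type,
      Fintype.prod_prod_type_right]
    simp [nuExp]
  rw [h2]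
  have h3 : ∀ c, ∏ k : Fin m, ((X (Sum.inl k) * X (Sum.inr (k, c)) :
      MvPolynomial (Fin m ⊕ Fin m × Fin N) K)) ^ δ c k =
      (∏ k, X (Sum.inl k) ^ δ c k) * ∏ k, X (Sum.inr (k, c)) ^ δ c k := by
    intro c
    rw [← Finset.prod_mul_distrib]
    exact Finset.prod_congr rfl fun k _ => mul_pow _ _ _
  have h4 : ∏ k, (X (Sum.inl k) : MvPolynomial (Fin m ⊕ Fin m × Fin N) K) ^ (∑ c, δ c k) =
      ∏ c, ∏ k, X (Sum.inl k) ^ δ c k := by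
    rw [Finset.prod_comm]
    exact Finset.prod_congr rfl fun k _ => (Finset.prod_pow_eq_pow_sum _ _ _).symm
  simp only [h3, h4, pow_add, Finset.prod_mul_distrib, map_mul, Nat.cast_prod, map_prod,
    map_natCast]
  ring

/-- Exponents as a function on naturals. -/
def natExp (μ : Fin (m + 1) × Fin N →₀ ℕ) (i c : ℕ) : ℕ :=
  if h : i < m + 1 ∧ c < N then μ (⟨i, h.1⟩, ⟨c, h.2⟩) else 0

/-- Greedy scan: the current row when reaching column `c`. -/
def scan (μ : Fin (m + 1) × Fin N →₀ ℕ) : ℕ → ℕ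
  | 0 => 0
  | c + 1 => if scan μ c < m ∧ 0 < natExp μ (scan μ c) c then scan μ c + 1 else scan μ c

def scanKey (μ : Fin (m + 1) × Fin N →₀ ℕ) (c : Fin N) : ℕ :=
  if scan μ c < m then natExp μ (scan μ c) c else 0

theorem scan_le (μ : Fin (m + 1) × Fin N →₀ ℕ) (c : ℕ) : scan μ c ≤ m := by
  induction c with
  | zero => simp [scan]
  | succ c ih =>
    rw [scan]
    split_ifs with h <;> omega

theorem scan_mono (μ : Fin (m + 1) × Fin N →₀ ℕ) : Monotone (scan μ) := by
  refine monotone_nat_of_le_succ fun c => ?_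
  rw [scan]
  split_ifs with h <;> omega

theorem scan_chain (μ : Fin (m + 1) × Fin N →₀ ℕ) (c : ℕ) :
    ∃ g : ℕ → ℕ, (∀ i < scan μ c, g i < c ∧ 0 < natExp μ i (g i)) ∧
      ∀ i j, i < j → j < scan μ c → g i < g j := by
  induction c with
  | zero => exact ⟨id, by simp [scan], by simp [scan]⟩
  | succ c ih =>
    obtain ⟨g, hg1, hg2⟩ := ih
    rw [scan]
    split_ifs with h
    · refine ⟨fun i => if i < scan μ c then g i else c, ?_, ?_⟩
      · intro i hi
        by_cases h' : i < scan μ c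
        · simp only [h', if_true]
          have := hg1 i h'
          exact ⟨by omega, this.2⟩
        · have : i = scan μ c := by omega
          subst this
          simp [h.2]
      · intro i j hij hj
        by_cases h' : j < scan μ c
        · simp only [h', hij.trans h', if_true]
          exact hg2 i j hij h'
        · have hi : i < scan μ c := by omega
          simp only [h', hi, if_true, if_false]
          exact (hg1 i hi).1
    · exact ⟨g, fun i hi => ⟨by have := (hg1 i hi).1; omega, (hg1 i hi).2⟩, hg2⟩

theorem natExp_eq (μ : Fin (m + 1) × Fin N →₀ ℕ) (i : Fin (m + 1)) (c : Fin N) :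
    natExp μ i c = μ (i, c) := by
  rw [natExp, dif_pos ⟨i.2, c.2⟩]

theorem last_zero_of_std (μ : Fin (m + 1) × Fin N →₀ ℕ)
    (hstd : ¬ ∃ cs : Fin (m + 1) → Fin N, StrictMono cs ∧ ∀ i, 0 < μ (i, cs i))
    (c : Fin N) (hc : scan μ c = m) : μ (Fin.last m, c) = 0 := by
  by_contra hne
  obtain ⟨g, hg1, hg2⟩ := scan_chain μ c
  rw [hc] at hg1 hg2
  apply hstd
  have hlt : ∀ i < m, g i < N := fun i hi => (hg1 i hi).1.trans c.2
  refine ⟨fun i => if h : i.val < m then ⟨g i, hlt i h⟩ else c, ?_, ?_⟩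
  · intro i j hij
    have hij' : i.val < j.val := hij
    have hi : i.val < m := by have := j.2; omega
    by_cases hj : j.val < m
    · simp only [hi, hj, dif_pos, Fin.mk_lt_mk]
      exact hg2 _ _ hij' hj
    · simp only [hi, hj, dif_pos, dif_neg, not_false_eq_true]
      exact (hg1 i hi).1
  · intro i
    by_cases hi : i.val < m
    · simp only [hi, dif_pos]
      have := (hg1 i hi).2
      rwa [natExp, dif_pos ⟨i.2, hlt i hi⟩] at this
    · simp only [hi, dif_neg, not_false_eq_true]
      have : i = Fin.last m := Fin.ext (by have := i.2; simp; omega)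
      rw [this]
      omega

theorem scan_congr (μ μ₀ : Fin (m + 1) × Fin N →₀ ℕ) (c : ℕ)
    (h : ∀ c' : Fin N, c'.val < c → scanKey μ c' = scanKey μ₀ c') (hc : c ≤ N) :
    scan μ c = scan μ₀ c := by
  induction c with
  | zero => simp [scan]
  | succ c ih =>
    have h1 := ih (fun c' hc' => h c' (by omega)) (by omega)
    have h2 := h ⟨c, by omega⟩ (by simp)
    simp only [scanKey] at h2
    rw [scan, scan]
    rw [h1] at h2 ⊢
    by_cases hs : scan μ₀ c < m
    · simp only [hs, if_true] at h2
      rw [h2]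
    · simp [hs]

def delta0 (μ : Fin (m + 1) × Fin N →₀ ℕ) (c : Fin N) (k : Fin m) : ℕ :=
  if k.val = scan μ c then μ (Fin.last m, c) else 0

theorem source_unique (μ₀ μ : Fin (m + 1) × Fin N →₀ ℕ)
    (hstd : ¬ ∃ cs : Fin (m + 1) → Fin N, StrictMono cs ∧ ∀ i, 0 < μ₀ (i, cs i))
    (hmax : toLex (scanKey μ) ≤ toLex (scanKey μ₀))
    (δ : Fin N → Fin m → ℕ) (hδ : ∀ c, ∑ k, δ c k = μ (Fin.last m, c))
    (hδ₀ : ∀ c, ∑ k, delta0 μ₀ c k = μ₀ (Fin.last m, c))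
    (E1 : ∀ k c, μ (k.castSucc, c) + δ c k = μ₀ (k.castSucc, c) + delta0 μ₀ c k)
    (E2 : ∀ k, ∑ c, δ c k = ∑ c, delta0 μ₀ c k) :
    μ = μ₀ ∧ δ = delta0 μ₀ := by
  have hkey : ∀ (ν : Fin (m + 1) × Fin N →₀ ℕ) (c : Fin N) (k : Fin m), k.val = scan ν c →
      scanKey ν c = ν (k.castSucc, c) := by
    intro ν c k hk
    rw [scanKey, ← hk, if_pos k.2]
    exact natExp_eq ν k.castSucc c
  have hge : ∀ c : Fin N, (∀ c' < c, scanKey μ c' = scanKey μ₀ c') → ∀ c' ≤ c, scan μ c' = scan μ₀ c' :=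
    fun c h c' hc' => scan_congr μ μ₀ c' (fun c'' h'' => h c'' (lt_of_lt_of_le (show c'' < c' from h'') hc')) (by omega)
  have claim2 : ∀ c : Fin N, (∀ c' < c, scanKey μ c' = scanKey μ₀ c') →
      scanKey μ₀ c ≤ scanKey μ c := by
    intro c hc
    have hst := hge c hc
    by_cases hs : scan μ₀ c < m
    swap
    · simp [scanKey, hs]
    set k : Fin m := ⟨scan μ₀ c, hs⟩ with hk
    rw [hkey μ₀ c k rfl, hkey μ c k (hst c le_rfl).symm]
    by_contra hcon
    push Not at hcon
    have hpos : 0 < natExp μ₀ (scan μ₀ c) c := by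
      have := natExp_eq μ₀ k.castSucc c
      change natExp μ₀ (scan μ₀ c) c = _ at this
      omega
    have hlt : ∑ c, delta0 μ₀ c k < ∑ c, δ c k := by
      refine Finset.sum_lt_sum (fun c' _ => ?_) ⟨c, Finset.mem_univ _, ?_⟩
      · rcases lt_trichotomy c' c with h | h | h
        · by_cases hsc : k.val = scan μ₀ c'
          · have e := hc c' h
            rw [hkey μ₀ c' k hsc, hkey μ c' k (by rw [hsc, hst c' h.le])] at e
            have := E1 k c'
            omega
          · simp [delta0, hsc]
        · subst h
          have := E1 k c'
          omega
        · have h1 : scan μ₀ (c + 1) ≤ scan μ₀ c' := scan_mono μ₀ (Nat.succ_le_of_lt h)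
          rw [scan, if_pos ⟨hs, hpos⟩] at h1
          have : k.val ≠ scan μ₀ c' := by rw [hk]; simp only; omega
          simp [delta0, this]
      · have := E1 k c
        omega
    rw [E2 k] at hlt
    exact lt_irrefl _ hlt
  have hkeys : scanKey μ = scanKey μ₀ := by
    by_contra hne
    have hlt : toLex (scanKey μ) < toLex (scanKey μ₀) :=
      lt_of_le_of_ne hmax (fun h => hne (toLex.injective h))
    obtain ⟨c, hc1, hc2⟩ := hlt
    exact absurd (claim2 c hc1) (not_le.2 hc2)
  have hst : ∀ c : Fin N, scan μ c = scan μ₀ c := fun c =>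
    hge c (fun c' _ => congrFun hkeys c') c le_rfl
  have hle : ∀ k c, delta0 μ₀ c k ≤ δ c k := by
    intro k c
    by_cases hsc : k.val = scan μ₀ c
    · have e := congrFun hkeys c
      rw [hkey μ₀ c k hsc, hkey μ c k (by rw [hsc, hst c])] at e
      have := E1 k c
      omega
    · simp [delta0, hsc]
  have hδeq : ∀ k c, delta0 μ₀ c k = δ c k := by
    intro k c
    exact (Finset.sum_eq_sum_iff_of_le (fun c _ => hle k c)).1 (E2 k).symm c (Finset.mem_univ _)
  refine ⟨?_, ?_⟩
  · ext ⟨i, c⟩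
    refine Fin.lastCases ?_ (fun k => ?_) i
    · rw [← hδ, ← hδ₀]
      exact Finset.sum_congr rfl fun k _ => (hδeq k c).symm
    · have := E1 k c
      rw [hδeq] at this
      omega
  · funext c k
    exact (hδeq k c).symm

/-- A nonzero element of the kernel has a monomial divisible by a diagonal chain. -/
theorem maxminor_std (f : MvPolynomial (Fin (m + 1) × Fin N) K) (hf : f ≠ 0)
    (hφ : phiHom K m N f = 0) :
    ∃ μ ∈ f.support, ∃ cs : Fin (m + 1) → Fin N, StrictMono cs ∧ ∀ i, 0 < μ (i, cs i) := by
  classical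
  by_contra hcon
  push Not at hcon
  have hne : f.support.Nonempty := by
    rwa [Finset.nonempty_iff_ne_empty, Ne, MvPolynomial.support_eq_empty]
  obtain ⟨μ₀, hμ₀, hmax⟩ := Finset.exists_max_image f.support (fun μ => toLex (scanKey μ)) hne
  have hstd : ¬ ∃ cs : Fin (m + 1) → Fin N, StrictMono cs ∧ ∀ i, 0 < μ₀ (i, cs i) := by
    rintro ⟨cs, h1, h2⟩
    obtain ⟨i, hi⟩ := hcon μ₀ hμ₀ cs h1
    have := h2 i
    omega
  have hδ₀ : ∀ c, ∑ k, delta0 μ₀ c k = μ₀ (Fin.last m, c) := by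
    intro c
    by_cases hs : scan μ₀ c < m
    · rw [Finset.sum_eq_single (⟨scan μ₀ c, hs⟩ : Fin m)]
      · simp [delta0]
      · intro k _ hk
        have : k.val ≠ scan μ₀ c := fun h => hk (Fin.ext h)
        simp [delta0, this]
      · simp
    · have hsm : scan μ₀ c = m := le_antisymm (scan_le _ _) (not_lt.1 hs)
      rw [last_zero_of_std μ₀ hstd c hsm]
      simp [delta0, last_zero_of_std μ₀ hstd c hsm]
  have hmult : ∀ c, Nat.multinomial Finset.univ (delta0 μ₀ c) = 1 := by
    intro c
    have h1 := Nat.multinomial_spec Finset.univ (delta0 μ₀ c)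
    rw [hδ₀] at h1
    have h2 : ∏ k, (delta0 μ₀ c k).factorial = (μ₀ (Fin.last m, c)).factorial := by
      by_cases hs : scan μ₀ c < m
      · rw [Finset.prod_eq_single (⟨scan μ₀ c, hs⟩ : Fin m)]
        · simp [delta0]
        · intro k _ hk
          have : k.val ≠ scan μ₀ c := fun h => hk (Fin.ext h)
          simp [delta0, this]
        · simp
      · have hsm : scan μ₀ c = m := le_antisymm (scan_le _ _) (not_lt.1 hs)
        simp [delta0, last_zero_of_std μ₀ hstd c hsm]
    rw [h2] at h1
    exact Nat.eq_of_mul_eq_mul_left (Nat.factorial_pos _) (by rw [h1, mul_one])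
  have hcoef : coeff (nuExp μ₀ (delta0 μ₀)) (phiHom K m N f) = coeff μ₀ f := by
    conv_lhs => rw [f.as_sum]
    rw [map_sum, coeff_sum, Finset.sum_eq_single μ₀]
    · rw [phiHom_monomial, coeff_sum, Finset.sum_eq_single (delta0 μ₀)]
      · simp [hmult]
      · intro δ hδ hne'
        rw [coeff_monomial, if_neg]
        intro heq
        apply hne'
        rw [Fintype.mem_piFinset] at hδ
        refine (source_unique μ₀ μ₀ hstd le_rfl δ (fun c => (Finset.mem_piAntidiag.1 (hδ c)).1)
          hδ₀ (fun k c => ?_) (fun k => ?_)).2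
        · simpa [nuExp] using DFunLike.congr_fun heq (Sum.inr (k, c))
        · simpa [nuExp] using DFunLike.congr_fun heq (Sum.inl k)
      · intro h
        exfalso
        apply h
        rw [Fintype.mem_piFinset]
        intro c
        rw [Finset.mem_piAntidiag]
        exact ⟨hδ₀ c, by simp⟩
    · intro μ hμ hne'
      rw [phiHom_monomial, coeff_sum]
      refine Finset.sum_eq_zero fun δ hδ => ?_
      rw [coeff_monomial, if_neg]
      intro heq
      apply hne'
      rw [Fintype.mem_piFinset] at hδ
      refine (source_unique μ₀ μ hstd (hmax μ hμ) δ (fun c => (Finset.mem_piAntidiag.1 (hδ c)).1)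
        hδ₀ (fun k c => ?_) (fun k => ?_)).1
      · simpa [nuExp] using DFunLike.congr_fun heq (Sum.inr (k, c))
      · simpa [nuExp] using DFunLike.congr_fun heq (Sum.inl k)
    · intro h
      exact absurd hμ₀ h
  rw [hφ, coeff_zero] at hcoef
  exact MvPolynomial.mem_support_iff.1 hμ₀ hcoef.symm

/-- Packaged version for arbitrary names of variables. -/
theorem exists_phi (K : Type*) [Field K] (M N : ℕ) (hM : 0 < M) {σ : Type*} (v : Fin M × Fin N ≃ σ) :
    ∃ (k : ℕ) (φ : MvPolynomial σ K →+* MvPolynomial (Fin k ⊕ Fin k × Fin N) K)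
      (w : Fin M → MvPolynomial (Fin k ⊕ Fin k × Fin N) K), (∃ i, w i ≠ 0) ∧
      (∀ c, ∑ i, w i * φ (X (v (i, c))) = 0) ∧
      ∀ f, f ≠ 0 → φ f = 0 → ∃ μ ∈ f.support, ∃ cs : Fin M → Fin N, StrictMono cs ∧
        ∀ i, 0 < μ (v (i, cs i)) := by
  obtain ⟨m, rfl⟩ : ∃ m, M = m + 1 := ⟨M - 1, by omega⟩
  refine ⟨m, ((phiHom K m N).comp (rename v.symm) : MvPolynomial σ K →ₐ[K] _).toRingHom,
    phiKer K m N, ⟨Fin.last m, by simp [phiKer_last]⟩, fun c => ?_, fun f hf hφ => ?_⟩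
  · have := phiKer_sum (K := K) (m := m) c
    simpa [phiHom] using this
  · have h0 : rename v.symm f ≠ 0 := by
      intro h
      exact hf (rename_injective _ v.symm.injective (by rw [h, map_zero]))
    obtain ⟨μ, hμ, cs, hcs, hpos⟩ := maxminor_std (rename v.symm f) h0 hφ
    rw [support_rename_of_injective v.symm.injective, Finset.mem_image] at hμ
    obtain ⟨μ', hμ', rfl⟩ := hμ
    refine ⟨μ', hμ', cs, hcs, fun i => ?_⟩
    have := hpos i
    have e : (i, cs i) = v.symm (v (i, cs i)) := by simp
    rw [e, Finsupp.mapDomain_apply v.symm.injective] at this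
    exact this

end MaxMinors

section DetLead

variable {σ K : Type*} [Field K]

/-- A matrix whose entries are sums of (labelled) variables. -/
def labMat (K : Type*) [Field K] {ι : Type*} (al : ι → ι → Fin 2 → Prop) (u : ι → ι → Fin 2 → σ) :
    Matrix ι ι (Polynomial (MvPolynomial σ K)) := by
  classical
  exact Matrix.of fun s s' => ∑ l : Fin 2,
    if al s s' l then Polynomial.C (X (u s s' l)) * Polynomial.X ^ l.val else 0

theorem labMat_coeff {ι : Type*} [Fintype ι] [DecidableEq ι] (al : ι → ι → Fin 2 → Prop)
    (u : ι → ι → Fin 2 → σ) (q : ℕ) (μ : σ →₀ ℕ) [∀ s s' l, Decidable (al s s' l)]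
    [DecidableEq σ] :
    MvPolynomial.coeff μ ((labMat K al u).det.coeff q) =
      ∑ p : Equiv.Perm ι, ∑ l : ι → Fin 2,
        if (∀ s, al s (p s) (l s)) ∧ (∑ s, (l s).val = q) ∧
          (∑ s, Finsupp.single (u s (p s) (l s)) 1 = μ) then ((Equiv.Perm.sign p : ℤ) : K) else 0 := by
  classical
  rw [← Matrix.det_transpose, Matrix.det_apply', Polynomial.finsetSum_coeff,
    MvPolynomial.coeff_sum]
  refine Finset.sum_congr rfl fun p _ => ?_
  have h1 : ∏ s, (labMat K al u).transpose (p s) s = ∑ l : ι → Fin 2,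
      if (∀ s, al s (p s) (l s)) then
        Polynomial.C (monomial (∑ s, Finsupp.single (u s (p s) (l s)) 1) (1 : K)) *
          Polynomial.X ^ (∑ s, (l s).val) else 0 := by
    simp only [labMat, Matrix.transpose_apply, Matrix.of_apply]
    rw [Finset.prod_univ_sum]
    rw [Fintype.piFinset_univ]
    refine Finset.sum_congr rfl fun l _ => ?_
    have := Finset.prod_ite_zero (s := Finset.univ) (p := fun s => al s (p s) (l s))
      (f := fun s => (Polynomial.C (X (u s (p s) (l s)) : MvPolynomial σ K)) *
        Polynomial.X ^ (l s).val)
    simp only [Finset.mem_univ, true_imp_iff] at this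
    convert this using 1
    · refine Finset.prod_congr rfl fun i _ => ?_
      congr
    congr 1
    rw [Finset.prod_mul_distrib, Finset.prod_pow_eq_pow_sum, ← map_prod]
    congr 2
    rw [MvPolynomial.monomial_sum_one]
    rfl
  rw [h1, Finset.mul_sum, Polynomial.finsetSum_coeff, MvPolynomial.coeff_sum]
  refine Finset.sum_congr rfl fun l _ => ?_
  have e : (((Equiv.Perm.sign p : ℤ) : Polynomial (MvPolynomial σ K))) =
      Polynomial.C (MvPolynomial.C ((Equiv.Perm.sign p : ℤ) : K)) := by simp
  rw [e]
  by_cases h : ∀ s, al s (p s) (l s)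
  · rw [if_pos h, Polynomial.coeff_C_mul, MvPolynomial.coeff_C_mul, Polynomial.coeff_C_mul,
      Polynomial.coeff_X_pow]
    by_cases h2 : ∑ s, (l s).val = q
    · rw [if_pos h2.symm, mul_one, MvPolynomial.coeff_monomial]
      simp [h, h2]
    · rw [if_neg (fun h' => h2 h'.symm)]
      simp [h2]
  · rw [if_neg h, if_neg (fun h' => h h'.1)]
    simp

theorem labMat_lead (t : TermOrder σ) {ι : Type*} [Fintype ι] [DecidableEq ι]
    (al : ι → ι → Fin 2 → Prop)
    (u : ι → ι → Fin 2 → σ) (lab : ι → Fin 2) (hid : ∀ s, al s s (lab s))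
    (hlt : ∀ (p : Equiv.Perm ι) (l : ι → Fin 2), (∀ s, al s (p s) (l s)) →
      ∑ s, (l s).val = ∑ s, (lab s).val → ¬ (p = 1 ∧ l = lab) →
      t.lt (∑ s, Finsupp.single (u s (p s) (l s)) 1) (∑ s, Finsupp.single (u s s (lab s)) 1)) :
    IsLeadMono t ((labMat K al u).det.coeff (∑ s, (lab s).val))
      (∑ s, Finsupp.single (u s s (lab s)) 1) := by
  classical
  constructor
  · rw [MvPolynomial.mem_support_iff, labMat_coeff, Finset.sum_eq_single 1, Finset.sum_eq_single lab]
    · rw [if_pos]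
      · simp
      · exact ⟨fun s => hid s, rfl, rfl⟩
    · intro l _ hl
      rw [if_neg]
      rintro ⟨h1, h2, h3⟩
      have := hlt 1 l h1 h2 (fun h => hl h.2)
      rw [h3] at this
      exact t.irrefl _ this
    · simp
    · intro p _ hp
      refine Finset.sum_eq_zero fun l _ => ?_
      rw [if_neg]
      rintro ⟨h1, h2, h3⟩
      have := hlt p l h1 h2 (fun h => hp h.1)
      rw [h3] at this
      exact t.irrefl _ this
    · simp
  · intro μ hμ hne
    rw [MvPolynomial.mem_support_iff, labMat_coeff] at hμ
    obtain ⟨p, -, hp⟩ := Finset.exists_ne_zero_of_sum_ne_zero hμ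
    obtain ⟨l, -, hl⟩ := Finset.exists_ne_zero_of_sum_ne_zero hp
    rw [Ne, ite_eq_right_iff, Classical.not_imp] at hl
    obtain ⟨⟨h1, h2, h3⟩, -⟩ := hl
    rw [← h3]
    refine hlt p l h1 h2 ?_
    rintro ⟨rfl, rfl⟩
    exact hne h3.symm

end DetLead

section HDet

variable {K : Type*} [Field K] {m n : ℕ}

/-- which labels are allowed in a given entry -/
def alAB (A B : Finset (Fin 2 × Fin m × Fin n)) (s s' : {s // s ∈ A ∪ B}) (l : Fin 2) : Prop :=
  (s.1 ∉ A → s'.1 ∈ B ∧ l = s.1.1) ∧ (s'.1 ∉ B → s.1 ∈ A ∧ l = s'.1.1)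

def uAB (A B : Finset (Fin 2 × Fin m × Fin n)) (s s' : {s // s ∈ A ∪ B}) (l : Fin 2) :
    Fin 2 × Fin m × Fin n := (l, s.1.2.1, s'.1.2.2)

/-- The polynomial lying in both ideals. -/
def hdet (K : Type*) [Field K] (A B : Finset (Fin 2 × Fin m × Fin n)) :
    MvPolynomial (Fin 2 × Fin m × Fin n) K :=
  (labMat K (alAB A B) (uAB A B)).det.coeff (∑ s : {s // s ∈ A ∪ B}, (s.1.1).val)

theorem hdet_map {S : Type*} [CommRing S] (ψ : MvPolynomial (Fin 2 × Fin m × Fin n) K →+* S)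
    (A B : Finset (Fin 2 × Fin m × Fin n))
    (h : ((labMat K (alAB A B) (uAB A B)).map (Polynomial.mapRingHom ψ)).det = 0) :
    ψ (hdet K A B) = 0 := by
  rw [hdet, ← Polynomial.coeff_map, ← Polynomial.coe_mapRingHom, RingHom.map_det,
    RingHom.mapMatrix_apply, h, Polynomial.coeff_zero]

open Classical in
theorem labMat_map_apply {S : Type*} [CommRing S]
    (ψ : MvPolynomial (Fin 2 × Fin m × Fin n) K →+* S)
    (A B : Finset (Fin 2 × Fin m × Fin n)) (s s' : {s // s ∈ A ∪ B}) :
    (labMat K (alAB A B) (uAB A B)).map (Polynomial.mapRingHom ψ) s s' =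
      ∑ l : Fin 2, if alAB A B s s' l then
        Polynomial.C (ψ (X (l, s.1.2.1, s'.1.2.2))) * Polynomial.X ^ l.val else 0 := by
  rw [Matrix.map_apply, labMat, Matrix.of_apply, map_sum]
  refine Finset.sum_congr rfl fun l _ => ?_
  split_ifs <;> simp [uAB]

theorem hdet_mem_H {S : Type*} [CommRing S] [IsDomain S]
    (ψ : MvPolynomial (Fin 2 × Fin m × Fin n) K →+* S)
    (w : Fin m → S) (hw : ∃ i, w i ≠ 0) (hker : ∀ l j, ∑ i, w i * ψ (X (l, i, j)) = 0)
    (A B : Finset (Fin 2 × Fin m × Fin n)) (hA : ∀ i, ∃ s ∈ A, s.2.1 = i)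
    (hinj : ∀ s ∈ A, ∀ s' ∈ A, s.2.1 = s'.2.1 → s = s') : ψ (hdet K A B) = 0 := by
  classical
  apply hdet_map
  rw [← Matrix.exists_vecMul_eq_zero_iff]
  refine ⟨fun s => if s.1 ∈ A then Polynomial.C (w s.1.2.1) else 0, ?_, ?_⟩
  · obtain ⟨i, hi⟩ := hw
    obtain ⟨s, hs, rfl⟩ := hA i
    intro h
    have := congrFun h ⟨s, Finset.mem_union_left _ hs⟩
    simp [hs, hi] at this
  · ext1 s'
    rw [Matrix.vecMul, dotProduct]
    simp only [labMat_map_apply, Finset.mul_sum]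
    rw [Finset.sum_comm]
    refine Finset.sum_eq_zero fun l _ => ?_
    by_cases hc : s'.1 ∉ B → l = s'.1.1
    · have key : ∀ s : {s // s ∈ A ∪ B}, ((if s.1 ∈ A then Polynomial.C (w s.1.2.1) else 0) *
          if alAB A B s s' l then
            Polynomial.C (ψ (X (l, s.1.2.1, s'.1.2.2))) * Polynomial.X ^ l.val else 0) =
          if s.1 ∈ A then Polynomial.C (w s.1.2.1 * ψ (X (l, s.1.2.1, s'.1.2.2))) *
            Polynomial.X ^ l.val else 0 := by
        intro s
        by_cases hs : s.1 ∈ A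
        · have : alAB A B s s' l := ⟨fun h => absurd hs h, fun h => ⟨hs, hc h⟩⟩
          rw [if_pos hs, if_pos this, if_pos hs, map_mul, mul_assoc]
        · simp [hs]
      rw [Finset.sum_congr rfl fun s _ => key s, ← Finset.sum_filter]
      have : ∑ i, Polynomial.C (w i * ψ (X (l, i, s'.1.2.2))) *
            (Polynomial.X : Polynomial S) ^ l.val = 0 := by
        rw [← Finset.sum_mul, ← map_sum, hker]
        simp
      rw [← this]
      refine Finset.sum_bij (fun s _ => s.1.2.1) (fun _ _ => Finset.mem_univ _) ?_ ?_ ?_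
      · intro a ha b hb h
        exact Subtype.ext (hinj _ (Finset.mem_filter.1 ha).2 _ (Finset.mem_filter.1 hb).2 h)
      · intro i _
        obtain ⟨s, hs, rfl⟩ := hA i
        exact ⟨⟨s, Finset.mem_union_left _ hs⟩, by simp [hs], rfl⟩
      · intro a _
        rfl
    · refine Finset.sum_eq_zero fun s _ => ?_
      rw [if_neg (c := alAB A B s s' l), mul_zero]
      intro h
      exact hc (fun h' => (h.2 h').2)

theorem hdet_mem_V {S : Type*} [CommRing S] [IsDomain S]
    (ψ : MvPolynomial (Fin 2 × Fin m × Fin n) K →+* S)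
    (w : Fin n → S) (hw : ∃ i, w i ≠ 0) (hker : ∀ l i, ∑ j, w j * ψ (X (l, i, j)) = 0)
    (A B : Finset (Fin 2 × Fin m × Fin n)) (hB : ∀ i, ∃ s ∈ B, s.2.2 = i)
    (hinj : ∀ s ∈ B, ∀ s' ∈ B, s.2.2 = s'.2.2 → s = s') : ψ (hdet K A B) = 0 := by
  classical
  apply hdet_map
  rw [← Matrix.exists_mulVec_eq_zero_iff]
  refine ⟨fun s => if s.1 ∈ B then Polynomial.C (w s.1.2.2) else 0, ?_, ?_⟩
  · obtain ⟨i, hi⟩ := hw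
    obtain ⟨s, hs, rfl⟩ := hB i
    intro h
    have := congrFun h ⟨s, Finset.mem_union_right _ hs⟩
    simp [hs, hi] at this
  · ext1 s'
    rw [Matrix.mulVec, dotProduct]
    simp only [labMat_map_apply, Finset.sum_mul]
    rw [Finset.sum_comm]
    refine Finset.sum_eq_zero fun l _ => ?_
    by_cases hc : s'.1 ∉ A → l = s'.1.1
    · have key : ∀ s : {s // s ∈ A ∪ B}, ((if alAB A B s' s l then
            Polynomial.C (ψ (X (l, s'.1.2.1, s.1.2.2))) * Polynomial.X ^ l.val else 0) *
            (if s.1 ∈ B then Polynomial.C (w s.1.2.2) else 0)) =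
          if s.1 ∈ B then Polynomial.C (w s.1.2.2 * ψ (X (l, s'.1.2.1, s.1.2.2))) *
            Polynomial.X ^ l.val else 0 := by
        intro s
        by_cases hs : s.1 ∈ B
        · have : alAB A B s' s l := ⟨fun h => ⟨hs, hc h⟩, fun h => absurd hs h⟩
          rw [if_pos hs, if_pos this, if_pos hs, map_mul]
          ring
        · simp [hs]
      rw [Finset.sum_congr rfl fun s _ => key s, ← Finset.sum_filter]
      have : ∑ i, Polynomial.C (w i * ψ (X (l, s'.1.2.1, i))) *
            (Polynomial.X : Polynomial S) ^ l.val = 0 := by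
        rw [← Finset.sum_mul, ← map_sum, hker]
        simp
      rw [← this]
      refine Finset.sum_bij (fun s _ => s.1.2.2) (fun _ _ => Finset.mem_univ _) ?_ ?_ ?_
      · intro a ha b hb h
        exact Subtype.ext (hinj _ (Finset.mem_filter.1 ha).2 _ (Finset.mem_filter.1 hb).2 h)
      · intro i _
        obtain ⟨s, hs, rfl⟩ := hB i
        exact ⟨⟨s, Finset.mem_union_right _ hs⟩, by simp [hs], rfl⟩
      · intro a _
        rfl
    · refine Finset.sum_eq_zero fun s _ => ?_
      rw [if_neg (c := alAB A B s' s l), zero_mul]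
      intro h
      exact hc (fun h' => (h.1 h').2)

end HDet

section Comb

variable {m n : ℕ}

def rk (s : Fin 2 × Fin m × Fin n) : ℤ ×ₗ ℤ ×ₗ ℤ :=
  toLex ((s.1.val : ℤ), toLex (if s.1.val = 0 then ((s.2.1.val : ℤ), (s.2.2.val : ℤ))
    else (-(s.2.1.val : ℤ), -(s.2.2.val : ℤ))))

theorem rk_lt_iff (s s' : Fin 2 × Fin m × Fin n) : rk s < rk s' ↔
    (s.1.val < s'.1.val ∨ (s.1.val = s'.1.val ∧
      ((s.1.val = 0 ∧ (s.2.1.val < s'.2.1.val ∨ s.2.1.val = s'.2.1.val ∧ s.2.2.val < s'.2.2.val)) ∨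
       (s.1.val = 1 ∧
        (s'.2.1.val < s.2.1.val ∨ s.2.1.val = s'.2.1.val ∧ s'.2.2.val < s.2.2.val))))) := by
  obtain ⟨⟨l, hl⟩, ⟨i, hi⟩, ⟨j, hj⟩⟩ := s
  obtain ⟨⟨l', hl'⟩, ⟨i', hi'⟩, ⟨j', hj'⟩⟩ := s'
  simp only [rk, Prod.Lex.toLex_lt_toLex]
  have h1 : l = 0 ∨ l = 1 := by omega
  have h2 : l' = 0 ∨ l' = 1 := by omega
  rcases h1 with rfl | rfl <;> rcases h2 with rfl | rfl <;> simp

theorem sigma_ext (s s' : Fin 2 × Fin m × Fin n) (h1 : s.1.val = s'.1.val)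
    (h2 : s.2.1.val = s'.2.1.val) (h3 : s.2.2.val = s'.2.2.val) : s = s' :=
  Prod.ext (Fin.ext h1) (Prod.ext (Fin.ext h2) (Fin.ext h3))

theorem rk_inj : Function.Injective (rk : Fin 2 × Fin m × Fin n → _) := by
  intro s s' h
  have h1 : ¬ rk s < rk s' := by rw [h]; exact lt_irrefl _
  have h2 : ¬ rk s' < rk s := by rw [h]; exact lt_irrefl _
  rw [rk_lt_iff] at h1 h2
  apply sigma_ext <;> omega

def tord0 (m n : ℕ) : TermOrder (Fin 2 × Fin m × Fin n) := rankLex rk rk_inj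

structure GoodAB (A B : Finset (Fin 2 × Fin m × Fin n)) : Prop where
  hA : ∀ s ∈ A, ∀ s' ∈ A, s.2.1.val < s'.2.1.val →
    s.1.val < s'.1.val ∨ (s.1.val = s'.1.val ∧ s.2.2.val < s'.2.2.val)
  hAi : ∀ s ∈ A, ∀ s' ∈ A, s.2.1.val = s'.2.1.val → s = s'
  hB : ∀ s ∈ B, ∀ s' ∈ B, s.2.2.val < s'.2.2.val →
    s.1.val < s'.1.val ∨ (s.1.val = s'.1.val ∧ s.2.1.val < s'.2.1.val)
  hBi : ∀ s ∈ B, ∀ s' ∈ B, s.2.2.val = s'.2.2.val → s = s'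
  d0A : ∀ g ∈ A, g ∈ B → g.1.val = 0 → ∀ e ∈ A, e.2.1.val ≤ g.2.1.val → e ∈ B
  d0B : ∀ g ∈ A, g ∈ B → g.1.val = 0 → ∀ e ∈ B, e.2.2.val ≤ g.2.2.val → e ∈ A
  d1A : ∀ g ∈ A, g ∈ B → g.1.val = 1 → ∀ e ∈ A, g.2.1.val ≤ e.2.1.val → e ∈ B
  d1B : ∀ g ∈ A, g ∈ B → g.1.val = 1 → ∀ e ∈ B, g.2.2.val ≤ e.2.2.val → e ∈ A

theorem count_label {A B : Finset (Fin 2 × Fin m × Fin n)}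
    (p : Equiv.Perm {s // s ∈ A ∪ B}) (l : {s // s ∈ A ∪ B} → Fin 2)
    (hal : ∀ s, alAB A B s (p s) (l s))
    (hsum : ∑ s, (l s).val = ∑ s : {s // s ∈ A ∪ B}, (s.1.1).val) (x : Fin 2) :
    (Finset.univ.filter fun s : {s // s ∈ A ∪ B} => s.1 ∈ A ∧ (p s).1 ∈ B ∧ l s = x).card =
    (Finset.univ.filter fun s : {s // s ∈ A ∪ B} => s.1 ∈ A ∧ s.1 ∈ B ∧ s.1.1 = x).card := by
  classical
  have htot : ∑ s, (if l s = x then (1:ℤ) else 0) =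
      ∑ s : {s // s ∈ A ∪ B}, if s.1.1 = x then (1:ℤ) else 0 := by
    have hs : ∑ s, ((l s).val : ℤ) = ∑ s : {s // s ∈ A ∪ B}, ((s.1.1).val : ℤ) := by
      exact_mod_cast hsum
    have hx : ∀ y : Fin 2, (if y = x then (1:ℤ) else 0) =
        if x = 1 then (y.val : ℤ) else 1 - (y.val : ℤ) := by
      intro y
      fin_cases x <;> fin_cases y <;> simp
    simp only [hx]
    split_ifs
    · exact hs
    · rw [Finset.sum_sub_distrib, Finset.sum_sub_distrib, hs]
  have h1 : ∀ s, (if s.1 ∈ A ∧ (p s).1 ∈ B ∧ l s = x then (1:ℤ) else 0) =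
      (if l s = x then (1:ℤ) else 0) - (if s.1 ∉ A ∧ s.1.1 = x then 1 else 0) -
      (if (p s).1 ∉ B ∧ (p s).1.1 = x then 1 else 0) := by
    intro s
    obtain ⟨ha, hb⟩ := hal s
    by_cases hsA : s.1 ∈ A <;> by_cases hsB : (p s).1 ∈ B
    · simp [hsA, hsB]
    · have := (hb hsB).2
      simp [hsA, hsB, this]
    · have := (ha hsA).2
      simp [hsA, hsB, this]
    · exact absurd (ha hsA).1 hsB
  have h2 : ∀ s : {s // s ∈ A ∪ B}, (if s.1 ∈ A ∧ s.1 ∈ B ∧ s.1.1 = x then (1:ℤ) else 0) =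
      (if s.1.1 = x then (1:ℤ) else 0) - (if s.1 ∉ A ∧ s.1.1 = x then 1 else 0) -
      (if s.1 ∉ B ∧ s.1.1 = x then 1 else 0) := by
    intro s
    have := Finset.mem_union.1 s.2
    by_cases hsA : s.1 ∈ A <;> by_cases hsB : s.1 ∈ B
    · simp [hsA, hsB]
    · simp [hsA, hsB]
    · simp [hsA, hsB]
    · tauto
  have key : ((Finset.univ.filter fun s : {s // s ∈ A ∪ B} =>
      s.1 ∈ A ∧ (p s).1 ∈ B ∧ l s = x).card : ℤ) =
    ((Finset.univ.filter fun s : {s // s ∈ A ∪ B} => s.1 ∈ A ∧ s.1 ∈ B ∧ s.1.1 = x).card : ℤ) := by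
    rw [Finset.card_filter, Finset.card_filter]
    push_cast
    rw [Finset.sum_congr rfl fun s _ => h1 s, Finset.sum_congr rfl fun s _ => h2 s]
    simp only [Finset.sum_sub_distrib]
    rw [htot, Equiv.sum_comp p (fun s => if s.1 ∉ B ∧ s.1.1 = x then (1:ℤ) else 0)]
  exact_mod_cast key

theorem step_rank {A B : Finset (Fin 2 × Fin m × Fin n)} (hG : GoodAB A B)
    (p : Equiv.Perm {s // s ∈ A ∪ B}) (l : {s // s ∈ A ∪ B} → Fin 2)
    (hal : ∀ s, alAB A B s (p s) (l s))
    (hsum : ∑ s, (l s).val = ∑ s : {s // s ∈ A ∪ B}, (s.1.1).val)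
    (e : {s // s ∈ A ∪ B}) (he : ¬ (p e = e ∧ l e = e.1.1))
    (hmin : ∀ s, rk s.1 < rk e.1 → p s = s ∧ l s = s.1.1)
    (s : {s // s ∈ A ∪ B}) (hs : ¬ rk s.1 < rk e.1) :
    rk e.1 < rk (uAB A B s (p s) (l s)) := by
  classical
  have hps : ¬ rk (p s).1 < rk e.1 := by
    intro h
    have h1 := (hmin _ h).1
    have h2 := p.injective h1
    rw [h2] at h
    exact hs h
  by_cases hmt : p s = s ∧ l s = s.1.1
  · have hne : s ≠ e := by rintro rfl; exact he hmt
    have : uAB A B s (p s) (l s) = s.1 := by rw [uAB, hmt.1, hmt.2]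
    rw [this]
    refine lt_of_le_of_ne (not_lt.1 hs) (fun h => hne (Subtype.ext (rk_inj h.symm)))
  obtain ⟨ha, hb⟩ := hal s
  have hse := Finset.mem_union.1 e.2
  have hss := Finset.mem_union.1 s.2
  have hsp := Finset.mem_union.1 (p s).2
  have hcount := count_label p l hal hsum (l s)
  generalize hs' : p s = s' at *
  by_cases hsA : s.1 ∈ A
  · by_cases hsB : s'.1 ∈ B
    · by_cases hg : ∃ g ∈ A, g ∈ B ∧ g.1 = l s ∧ rk e.1 ≤ rk g
      · obtain ⟨g, hgA, hgB, hgl, hge⟩ := hg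
        rw [← not_lt, rk_lt_iff] at hge
        rw [rk_lt_iff] at hs hps ⊢
        simp only [uAB]
        have hgl' := congrArg Fin.val hgl
        have hl2 := (l s).2
        have he2 := e.1.1.2
        have hs2 := s.1.1.2
        have hs2' := s'.1.1.2
        by_cases hl0 : (l s).val = 0
        · have heA : e.1 ∈ A ∧ e.1 ∈ B := by
            rcases hse with h | h
            · exact ⟨h, hG.d0A g hgA hgB (by omega) _ h (by omega)⟩
            · refine ⟨hG.d0B g hgA hgB (by omega) _ h ?_, h⟩
              by_contra hc
              have := hG.hB g hgB _ h (by omega)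
              omega
          have q1 : e.1.2.1.val ≤ s.1.2.1.val := by
            by_contra hc
            have := hG.hA _ hsA _ heA.1 (by omega)
            omega
          have q2 : e.1.2.2.val ≤ s'.1.2.2.val := by
            by_contra hc
            have := hG.hB _ hsB _ heA.2 (by omega)
            omega
          have q3 : ¬ (s.1.2.1.val = e.1.2.1.val ∧ s'.1.2.2.val = e.1.2.2.val) := by
            rintro ⟨h1, h2⟩
            have h1' := Subtype.ext (hG.hAi _ hsA _ heA.1 h1)
            have h2' := Subtype.ext (hG.hBi _ hsB _ heA.2 h2)
            refine hmt ⟨h2'.trans h1'.symm, Fin.ext ?_⟩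
            have h3 : s.1.1.val = e.1.1.val := by rw [h1']
            omega
          omega
        · by_cases he0 : e.1.1.val = 0
          · omega
          have heA : e.1 ∈ A ∧ e.1 ∈ B := by
            rcases hse with h | h
            · exact ⟨h, hG.d1A g hgA hgB (by omega) _ h (by omega)⟩
            · refine ⟨hG.d1B g hgA hgB (by omega) _ h ?_, h⟩
              by_contra hc
              have := hG.hB _ h g hgB (by omega)
              omega
          have q1 : s.1.2.1.val ≤ e.1.2.1.val := by
            by_contra hc
            have := hG.hA _ heA.1 _ hsA (by omega)
            omega
          have q2 : s'.1.2.2.val ≤ e.1.2.2.val := by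
            by_contra hc
            have := hG.hB _ heA.2 _ hsB (by omega)
            omega
          have q3 : ¬ (s.1.2.1.val = e.1.2.1.val ∧ s'.1.2.2.val = e.1.2.2.val) := by
            rintro ⟨h1, h2⟩
            have h1' := Subtype.ext (hG.hAi _ hsA _ heA.1 h1)
            have h2' := Subtype.ext (hG.hBi _ hsB _ heA.2 h2)
            refine hmt ⟨h2'.trans h1'.symm, Fin.ext ?_⟩
            have h3 : s.1.1.val = e.1.1.val := by rw [h1']
            omega
          omega
      · exfalso
        have hg2 : ∀ g : {s // s ∈ A ∪ B}, g.1 ∈ A → g.1 ∈ B → g.1.1 = l s → rk g.1 < rk e.1 := by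
          intro g h1 h2 h3
          by_contra h4
          exact hg ⟨g.1, h1, h2, h3, not_lt.1 h4⟩
        have hsub : (Finset.univ.filter fun z : {s // s ∈ A ∪ B} =>
              z.1 ∈ A ∧ z.1 ∈ B ∧ z.1.1 = l s) ⊆
            (Finset.univ.filter fun z : {s // s ∈ A ∪ B} =>
              z.1 ∈ A ∧ (p z).1 ∈ B ∧ l z = l s) := by
          intro z hz
          obtain ⟨-, h1, h2, h3⟩ := Finset.mem_filter.1 hz
          obtain ⟨h4, h5⟩ := hmin z (hg2 z h1 h2 h3)
          exact Finset.mem_filter.2 ⟨Finset.mem_univ _, h1, by rw [h4]; exact h2, h5.trans h3⟩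
        have heq := Finset.eq_of_subset_of_card_le hsub hcount.le
        have hmem : s ∈ (Finset.univ.filter fun z : {s // s ∈ A ∪ B} =>
              z.1 ∈ A ∧ (p z).1 ∈ B ∧ l z = l s) :=
          Finset.mem_filter.2 ⟨Finset.mem_univ _, hsA, by rw [hs']; exact hsB, rfl⟩
        rw [← heq] at hmem
        obtain ⟨-, h1, h2, h3⟩ := Finset.mem_filter.1 hmem
        exact hs (hg2 s h1 h2 h3)
    · have hl := congrArg Fin.val (hb hsB).2
      have hs'A : s'.1 ∈ A := hsp.resolve_right hsB
      have hne : s.1.2.1.val ≠ s'.1.2.1.val := by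
        intro h
        have h1 := Subtype.ext (hG.hAi _ hsA _ hs'A h)
        exact hmt ⟨h1.symm, by rw [(hb hsB).2, h1]⟩
      have h1 := hG.hA _ hsA _ hs'A
      have h2 := hG.hA _ hs'A _ hsA
      rw [rk_lt_iff] at hs hps ⊢
      simp only [uAB]
      have he2 := e.1.1.2
      have hs2 := s.1.1.2
      have hs2' := s'.1.1.2
      omega
  · have hl := congrArg Fin.val (ha hsA).2
    have hsB := hss.resolve_left hsA
    have hs'B := (ha hsA).1
    have hne : s.1.2.2.val ≠ s'.1.2.2.val := by
      intro h
      have h1 := Subtype.ext (hG.hBi _ hsB _ hs'B h)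
      exact hmt ⟨h1.symm, (ha hsA).2⟩
    have h1 := hG.hB _ hsB _ hs'B
    have h2 := hG.hB _ hs'B _ hsB
    rw [rk_lt_iff] at hs hps ⊢
    simp only [uAB]
    have he2 := e.1.1.2
    have hs2 := s.1.1.2
    have hs2' := s'.1.1.2
    omega

theorem term_lt {A B : Finset (Fin 2 × Fin m × Fin n)} (hG : GoodAB A B)
    (p : Equiv.Perm {s // s ∈ A ∪ B}) (l : {s // s ∈ A ∪ B} → Fin 2)
    (hal : ∀ s, alAB A B s (p s) (l s))
    (hsum : ∑ s, (l s).val = ∑ s : {s // s ∈ A ∪ B}, (s.1.1).val)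
    (hne : ¬ (p = 1 ∧ l = fun s => s.1.1)) :
    (tord0 m n).lt (∑ s, Finsupp.single (uAB A B s (p s) (l s)) 1)
      (∑ s : {s // s ∈ A ∪ B}, Finsupp.single (uAB A B s s (s.1.1)) 1) := by
  classical
  have hex : {s : {s // s ∈ A ∪ B} | ¬ (p s = s ∧ l s = s.1.1)}.Nonempty := by
    by_contra h
    rw [Set.not_nonempty_iff_eq_empty, Set.eq_empty_iff_forall_notMem] at h
    simp only [Set.mem_ofPred_eq, not_not] at h
    exact hne ⟨Equiv.ext fun s => (h s).1, funext fun s => (h s).2⟩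
  obtain ⟨e, he, hmin⟩ := Set.exists_min_image _ (fun s : {s // s ∈ A ∪ B} => rk s.1)
    (Set.toFinite _) hex
  have hmin' : ∀ s : {s // s ∈ A ∪ B}, rk s.1 < rk e.1 → p s = s ∧ l s = s.1.1 := by
    intro s hs
    by_contra h
    exact absurd (hmin s h) (not_le.2 hs)
  have hstep := step_rank hG p l hal hsum e he hmin'
  have happ : ∀ (f : {s // s ∈ A ∪ B} → Fin 2 × Fin m × Fin n) z,
      (∑ s, Finsupp.single (f s) 1 : (Fin 2 × Fin m × Fin n) →₀ ℕ) z =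
        ∑ s, if f s = z then 1 else 0 := by
    intro f z
    rw [Finsupp.finsetSum_apply]
    exact Finset.sum_congr rfl fun s _ => by rw [Finsupp.single_apply]
  refine ⟨e.1, ?_, ?_⟩
  · rw [happ, happ, Finset.sum_eq_zero]
    · refine Finset.sum_pos' (fun _ _ => Nat.zero_le _) ⟨e, Finset.mem_univ _, ?_⟩
      rw [if_pos (by rfl)]
      exact Nat.one_pos
    · intro s _
      rw [if_neg]
      intro h
      by_cases hs : rk s.1 < rk e.1
      · obtain ⟨h1, h2⟩ := hmin' s hs
        have : uAB A B s (p s) (l s) = s.1 := by rw [uAB, h1, h2]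
        rw [← h, this] at hs
        exact lt_irrefl _ hs
      · have := hstep s hs
        rw [h] at this
        exact lt_irrefl _ this
  · intro z hz
    rw [happ, happ]
    refine Finset.sum_congr rfl fun s _ => ?_
    by_cases hs : rk s.1 < rk e.1
    · obtain ⟨h1, h2⟩ := hmin' s hs
      rw [h1, h2]
    · rw [if_neg, if_neg]
      · intro h
        have : uAB A B s s s.1.1 = s.1 := rfl
        rw [this] at h
        rw [h] at hs
        exact hs hz
      · intro h
        have := hstep s hs
        rw [h] at this
        exact lt_irrefl _ (this.trans hz)

theorem hdet_lead (K : Type*) [Field K] {A B : Finset (Fin 2 × Fin m × Fin n)} (hG : GoodAB A B) :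
    IsLeadMono (tord0 m n) (hdet K A B) (∑ s ∈ A ∪ B, Finsupp.single s 1) := by
  classical
  have := labMat_lead (K := K) (tord0 m n) (alAB A B) (uAB A B) (fun s => s.1.1)
    (fun s => by
      have := Finset.mem_union.1 s.2
      exact ⟨fun h => ⟨this.resolve_left h, rfl⟩, fun h => ⟨this.resolve_right h, rfl⟩⟩)
    (fun p l h1 h2 h3 => term_lt hG p l h1 h2 h3)
  rw [← Finset.sum_coe_sort]
  exact this

end Comb

section Chains

variable {m n : ℕ}

theorem fin_gap {a b : ℕ} (f : Fin a → Fin b) (hf : StrictMono f) (d : ℕ) :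
    ∀ i i' : Fin a, i'.val = i.val + d → (f i).val + d ≤ (f i').val := by
  induction d with
  | zero =>
    intro i i' h
    have : i' = i := Fin.ext h
    rw [this]
    omega
  | succ d ih =>
    intro i i' h
    have h1 := ih i ⟨i.val + d, by have := i'.2; omega⟩ rfl
    have h2 : f ⟨i.val + d, by have := i'.2; omega⟩ < f i' := hf (by rw [Fin.lt_def]; simp; omega)
    rw [Fin.lt_def] at h2
    omega

theorem fin_gap' {a b : ℕ} (f : Fin a → Fin b) (hf : StrictMono f) (i i' : Fin a)
    (h : i.val ≤ i'.val) : (f i).val + (i'.val - i.val) ≤ (f i').val :=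
  fin_gap f hf _ i i' (by omega)

theorem strictMono_fin_id {a : ℕ} (f : Fin a → Fin a) (hf : StrictMono f) : f = id := by
  funext i
  have hi := i.2
  have h1 := fin_gap' f hf ⟨0, by omega⟩ i (Nat.zero_le _)
  have h2 := fin_gap' f hf i ⟨a - 1, by omega⟩ (by simp; omega)
  have h3 := (f ⟨a - 1, by omega⟩).2
  apply Fin.ext
  simp only [id] at *
  omega

theorem varH_eq (hn : 0 < n) (i : Fin m) (k : Fin (2 * n)) (s : Fin 2 × Fin m × Fin n) :
    varH 2 m n hn i k = s ↔ s.2.1 = i ∧ k.val = n * s.1.val + s.2.2.val := by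
  obtain ⟨l, i', j⟩ := s
  simp only [varH, Prod.mk.injEq]
  constructor
  · rintro ⟨h1, h2, h3⟩
    rw [← h1, ← h3]
    exact ⟨h2.symm, (Nat.div_add_mod _ _).symm⟩
  · rintro ⟨h1, h2⟩
    refine ⟨Fin.ext ?_, h1.symm, Fin.ext ?_⟩
    · simp only [h2]
      rw [Nat.mul_add_div hn, Nat.div_eq_of_lt j.2, add_zero]
    · simp only [h2]
      rw [Nat.mul_add_mod, Nat.mod_eq_of_lt j.2]

theorem varV_eq (hm : 0 < m) (j : Fin n) (k : Fin (2 * m)) (s : Fin 2 × Fin m × Fin n) :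
    varV 2 m n hm k j = s ↔ s.2.2 = j ∧ k.val = m * s.1.val + s.2.1.val := by
  obtain ⟨l, i, j'⟩ := s
  simp only [varV, Prod.mk.injEq]
  constructor
  · rintro ⟨h1, h2, h3⟩
    rw [← h1, ← h2]
    exact ⟨h3.symm, (Nat.div_add_mod _ _).symm⟩
  · rintro ⟨h1, h2⟩
    refine ⟨Fin.ext ?_, Fin.ext ?_, h1.symm⟩
    · simp only [h2]
      rw [Nat.mul_add_div hm, Nat.div_eq_of_lt i.2, add_zero]
    · simp only [h2]
      rw [Nat.mul_add_mod, Nat.mod_eq_of_lt i.2]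

theorem lab_lt {N : ℕ} (l : Fin 2) (j : Fin N) : N * l.val + j.val < 2 * N := by
  have h1 := l.2
  have h2 := j.2
  have : l.val = 0 ∨ l.val = 1 := by omega
  rcases this with h | h <;> rw [h] <;> omega

def equivH (m n : ℕ) (hn : 0 < n) : Fin m × Fin (2 * n) ≃ Fin 2 × Fin m × Fin n :=
  Equiv.ofBijective (fun q => varH 2 m n hn q.1 q.2) (by
    constructor
    · rintro ⟨i, k⟩ ⟨i', k'⟩ h
      simp only at h
      rw [varH_eq] at h
      have := ((varH_eq hn i' k' _).1 rfl)
      exact Prod.ext (h.1.symm.trans this.1) (Fin.ext (h.2.trans this.2.symm))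
    · rintro s
      exact ⟨(s.2.1, ⟨n * s.1.val + s.2.2.val, lab_lt _ _⟩), (varH_eq hn _ _ _).2 ⟨rfl, rfl⟩⟩)

def equivV (m n : ℕ) (hm : 0 < m) : Fin n × Fin (2 * m) ≃ Fin 2 × Fin m × Fin n :=
  Equiv.ofBijective (fun q => varV 2 m n hm q.2 q.1) (by
    constructor
    · rintro ⟨i, k⟩ ⟨i', k'⟩ h
      simp only at h
      rw [varV_eq] at h
      have := ((varV_eq hm i' k' _).1 rfl)
      exact Prod.ext (h.1.symm.trans this.1) (Fin.ext (h.2.trans this.2.symm))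
    · rintro s
      exact ⟨(s.2.2, ⟨m * s.1.val + s.2.1.val, lab_lt _ _⟩), (varV_eq hm _ _ _).2 ⟨rfl, rfl⟩⟩)

def setH (m n : ℕ) (hn : 0 < n) (cs : Fin m → Fin (2 * n)) : Finset (Fin 2 × Fin m × Fin n) :=
  Finset.univ.image fun i => varH 2 m n hn i (cs i)

def setV (m n : ℕ) (hm : 0 < m) (rs : Fin n → Fin (2 * m)) : Finset (Fin 2 × Fin m × Fin n) :=
  Finset.univ.image fun j => varV 2 m n hm (rs j) j

theorem mem_setH (hn : 0 < n) (cs : Fin m → Fin (2 * n)) (s : Fin 2 × Fin m × Fin n) :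
    s ∈ setH m n hn cs ↔ (s.1.val = 0 ∧ (cs s.2.1).val = s.2.2.val) ∨
      (s.1.val = 1 ∧ (cs s.2.1).val = n + s.2.2.val) := by
  have : s ∈ setH m n hn cs ↔ (cs s.2.1).val = n * s.1.val + s.2.2.val := by
    simp only [setH, Finset.mem_image, Finset.mem_univ, true_and, varH_eq]
    constructor
    · rintro ⟨i, h, h'⟩
      rw [h]
      exact h'
    · intro h
      exact ⟨_, rfl, h⟩
  rw [this]
  have h1 := s.1.2
  have : s.1.val = 0 ∨ s.1.val = 1 := by omega
  rcases this with h | h <;> rw [h] <;> simp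

theorem mem_setV (hm : 0 < m) (rs : Fin n → Fin (2 * m)) (s : Fin 2 × Fin m × Fin n) :
    s ∈ setV m n hm rs ↔ (s.1.val = 0 ∧ (rs s.2.2).val = s.2.1.val) ∨
      (s.1.val = 1 ∧ (rs s.2.2).val = m + s.2.1.val) := by
  have : s ∈ setV m n hm rs ↔ (rs s.2.2).val = m * s.1.val + s.2.1.val := by
    simp only [setV, Finset.mem_image, Finset.mem_univ, true_and, varV_eq]
    constructor
    · rintro ⟨i, h, h'⟩
      rw [h]
      exact h'
    · intro h
      exact ⟨_, rfl, h⟩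
  rw [this]
  have h1 := s.1.2
  have : s.1.val = 0 ∨ s.1.val = 1 := by omega
  rcases this with h | h <;> rw [h] <;> simp

theorem setH_lt (hn : 0 < n) (cs : Fin m → Fin (2 * n)) (hcs : StrictMono cs) :
    ∀ s ∈ setH m n hn cs, ∀ s' ∈ setH m n hn cs, s.2.1.val < s'.2.1.val →
      s.1.val < s'.1.val ∨ (s.1.val = s'.1.val ∧ s.2.2.val < s'.2.2.val) := by
  intro s hs s' hs' h
  rw [mem_setH] at hs hs'
  have h1 : (cs s.2.1).val < (cs s'.2.1).val := hcs h
  have h2 := s.2.2.2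
  have h3 := s'.2.2.2
  omega

theorem setH_inj (hn : 0 < n) (cs : Fin m → Fin (2 * n)) :
    ∀ s ∈ setH m n hn cs, ∀ s' ∈ setH m n hn cs, s.2.1.val = s'.2.1.val → s = s' := by
  intro s hs s' hs' h
  rw [mem_setH] at hs hs'
  have h1 : (cs s.2.1).val = (cs s'.2.1).val := by rw [Fin.ext h]
  have h2 := s.2.2.2
  have h3 := s'.2.2.2
  exact sigma_ext _ _ (by omega) h (by omega)

theorem setV_lt (hm : 0 < m) (rs : Fin n → Fin (2 * m)) (hrs : StrictMono rs) :
    ∀ s ∈ setV m n hm rs, ∀ s' ∈ setV m n hm rs, s.2.2.val < s'.2.2.val →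
      s.1.val < s'.1.val ∨ (s.1.val = s'.1.val ∧ s.2.1.val < s'.2.1.val) := by
  intro s hs s' hs' h
  rw [mem_setV] at hs hs'
  have h1 : (rs s.2.2).val < (rs s'.2.2).val := hrs h
  have h2 := s.2.1.2
  have h3 := s'.2.1.2
  omega

theorem setV_inj (hm : 0 < m) (rs : Fin n → Fin (2 * m)) :
    ∀ s ∈ setV m n hm rs, ∀ s' ∈ setV m n hm rs, s.2.2.val = s'.2.2.val → s = s' := by
  intro s hs s' hs' h
  rw [mem_setV] at hs hs'
  have h1 : (rs s.2.2).val = (rs s'.2.2).val := by rw [Fin.ext h]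
  have h2 := s.2.1.2
  have h3 := s'.2.1.2
  exact sigma_ext _ _ (by omega) (by omega) h

theorem good_HV (hm : 0 < m) (hn : 0 < n) (cs : Fin m → Fin (2 * n)) (hcs : StrictMono cs)
    (rs : Fin n → Fin (2 * m)) (hrs : StrictMono rs) :
    GoodAB (setH m n hn cs) (setV m n hm rs) := by
  have c0 := fun i : Fin m => fin_gap' cs hcs ⟨0, hm⟩ i (Nat.zero_le _)
  have c1 := fun i : Fin m => fin_gap' cs hcs i ⟨m - 1, by omega⟩ (by have := i.2; simp; omega)
  have r0 := fun i : Fin n => fin_gap' rs hrs ⟨0, hn⟩ i (Nat.zero_le _)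
  have r1 := fun i : Fin n => fin_gap' rs hrs i ⟨n - 1, by omega⟩ (by have := i.2; simp; omega)
  have cl := (cs ⟨m - 1, by omega⟩).2
  have rl := (rs ⟨n - 1, by omega⟩).2
  simp only at c0 c1 r0 r1
  refine ⟨setH_lt hn cs hcs, setH_inj hn cs, setV_lt hm rs hrs, setV_inj hm rs, ?_, ?_, ?_, ?_⟩
  · intro g hgA hgB h0 e heA hle
    rw [mem_setH] at hgA heA
    rw [mem_setV] at hgB ⊢
    have a1 := c0 g.2.1
    have a2 := r0 g.2.2
    have a3 := c0 e.2.1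
    have a4 := fin_gap' cs hcs e.2.1 g.2.1 hle
    have b1 := g.2.2.2
    have a5 := r0 e.2.2
    have a6 := fin_gap' rs hrs e.2.2 g.2.2 (by omega)
    omega
  · intro g hgA hgB h0 e heB hle
    rw [mem_setV] at hgB heB
    rw [mem_setH] at hgA ⊢
    have a1 := c0 g.2.1
    have a2 := r0 g.2.2
    have a3 := r0 e.2.2
    have a4 := fin_gap' rs hrs e.2.2 g.2.2 hle
    have b1 := g.2.1.2
    have a5 := c0 e.2.1
    have a6 := fin_gap' cs hcs e.2.1 g.2.1 (by omega)
    omega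
  · intro g hgA hgB h0 e heA hle
    rw [mem_setH] at hgA heA
    rw [mem_setV] at hgB ⊢
    have a1 := c1 g.2.1
    have a2 := r1 g.2.2
    have a3 := c1 e.2.1
    have a4 := fin_gap' cs hcs g.2.1 e.2.1 hle
    have b1 := g.2.2.2
    have b2 := g.2.1.2
    have b3 := e.2.2.2
    have b4 := e.2.1.2
    have a5 := r1 e.2.2
    have a6 := fin_gap' rs hrs g.2.2 e.2.2 (by omega)
    omega
  · intro g hgA hgB h0 e heB hle
    rw [mem_setV] at hgB heB
    rw [mem_setH] at hgA ⊢
    have a1 := c1 g.2.1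
    have a2 := r1 g.2.2
    have a3 := r1 e.2.2
    have a4 := fin_gap' rs hrs g.2.2 e.2.2 hle
    have b1 := g.2.2.2
    have b2 := g.2.1.2
    have b3 := e.2.2.2
    have b4 := e.2.1.2
    have a5 := c1 e.2.1
    have a6 := fin_gap' cs hcs g.2.1 e.2.1 (by omega)
    omega

theorem good_H (hn : 0 < n) (cs : Fin m → Fin (2 * n)) (hcs : StrictMono cs) :
    GoodAB (setH m n hn cs) ∅ := by
  refine ⟨setH_lt hn cs hcs, setH_inj hn cs, ?_, ?_, ?_, ?_, ?_, ?_⟩ <;> simp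

theorem good_V (hm : 0 < m) (rs : Fin n → Fin (2 * m)) (hrs : StrictMono rs) :
    GoodAB ∅ (setV m n hm rs) := by
  refine ⟨?_, ?_, setV_lt hm rs hrs, setV_inj hm rs, ?_, ?_, ?_, ?_⟩ <;> simp

theorem sum_setH (hn : 0 < n) (cs : Fin m → Fin (2 * n)) :
    ∑ i, Finsupp.single (varH 2 m n hn i (cs i)) 1 =
      (∑ s ∈ setH m n hn cs, Finsupp.single s 1 : (Fin 2 × Fin m × Fin n) →₀ ℕ) := by
  rw [setH, Finset.sum_image]
  intro i _ i' _ h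
  exact congrArg (fun z => z.2.1) h

theorem sum_setV (hm : 0 < m) (rs : Fin n → Fin (2 * m)) :
    ∑ j, Finsupp.single (varV 2 m n hm (rs j) j) 1 =
      (∑ s ∈ setV m n hm rs, Finsupp.single s 1 : (Fin 2 × Fin m × Fin n) →₀ ℕ) := by
  rw [setV, Finset.sum_image]
  intro i _ i' _ h
  exact congrArg (fun z => z.2.2) h

theorem sum_single_apply {σ : Type*} [DecidableEq σ] (S : Finset σ) (z : σ) :
    (∑ s ∈ S, Finsupp.single s 1 : σ →₀ ℕ) z = if z ∈ S then 1 else 0 := by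
  rw [Finsupp.finsetSum_apply]
  simp [Finsupp.single_apply]

theorem sum_single_sup {σ : Type*} [DecidableEq σ] (S T : Finset σ) :
    (∑ s ∈ S, Finsupp.single s 1 : σ →₀ ℕ) ⊔ ∑ s ∈ T, Finsupp.single s 1 =
      ∑ s ∈ S ∪ T, Finsupp.single s 1 := by
  ext z
  rw [Finsupp.sup_apply, sum_single_apply, sum_single_apply, sum_single_apply]
  by_cases h1 : z ∈ S <;> by_cases h2 : z ∈ T <;> simp [h1, h2]

theorem sum_single_le {σ : Type*} [DecidableEq σ] (S : Finset σ) (μ : σ →₀ ℕ)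
    (h : ∀ s ∈ S, 0 < μ s) : (∑ s ∈ S, Finsupp.single s 1 : σ →₀ ℕ) ≤ μ := by
  intro z
  rw [sum_single_apply]
  split_ifs with hz
  · exact h z hz
  · exact Nat.zero_le _

end Chains

section Final

variable {K : Type*} [Field K] {m n : ℕ}

theorem hdet_empty_mono (A B : Finset (Fin 2 × Fin m × Fin n)) (hG : GoodAB A B) :
    IsLeadMono (tord0 m n) (hdet K A B)
      ((∑ s ∈ A, Finsupp.single s 1) ⊔ (∑ s ∈ B, Finsupp.single s 1)) := by
  rw [sum_single_sup]
  exact hdet_lead K hG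

def LH (m n : ℕ) (hn : 0 < n) : Set ((Fin 2 × Fin m × Fin n) →₀ ℕ) :=
  {a | ∃ cs : Fin m → Fin (2 * n), StrictMono cs ∧
    a = ∑ i, Finsupp.single (varH 2 m n hn i (cs i)) 1}

def LV (m n : ℕ) (hm : 0 < m) : Set ((Fin 2 × Fin m × Fin n) →₀ ℕ) :=
  {a | ∃ rs : Fin n → Fin (2 * m), StrictMono rs ∧
    a = ∑ j, Finsupp.single (varV 2 m n hm (rs j) j) 1}

theorem std_zero (hm : 0 < m) (hn : 0 < n) (F : MvPolynomial (Fin 2 × Fin m × Fin n) K)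
    (hF : F ∈ doubleDetIdeal K 2 m n m n hm hn)
    (hstd : ∀ μ ∈ F.support, ∀ a ∈ LH m n hn ∪ LV m n hm, ¬ a ≤ μ) : F = 0 := by
  classical
  obtain ⟨kH, φ, w, hw, hker, hφ⟩ := exists_phi K m (2 * n) hm (equivH m n hn)
  obtain ⟨kV, ψ, w', hw', hker', hψ⟩ := exists_phi K n (2 * m) hn (equivV m n hm)
  have eH : ∀ i c, equivH m n hn (i, c) = varH 2 m n hn i c := fun _ _ => rfl
  have eV : ∀ i c, equivV m n hm (i, c) = varV 2 m n hm c i := fun _ _ => rfl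
  simp only [eH] at hker hφ
  simp only [eV] at hker' hψ
  have kH' : ∀ l j, ∑ i, w i * φ (X (l, i, j)) = 0 := by
    intro l j
    rw [← hker ⟨n * l.val + j.val, lab_lt _ _⟩]
    refine Finset.sum_congr rfl fun i _ => ?_
    rw [(varH_eq hn i ⟨n * l.val + j.val, lab_lt _ _⟩ (l, i, j)).2 ⟨rfl, rfl⟩]
  have kV' : ∀ l i, ∑ j, w' j * ψ (X (l, i, j)) = 0 := by
    intro l i
    rw [← hker' ⟨m * l.val + i.val, lab_lt _ _⟩]
    refine Finset.sum_congr rfl fun j _ => ?_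
    rw [(varV_eq hm j ⟨m * l.val + i.val, lab_lt _ _⟩ (l, i, j)).2 ⟨rfl, rfl⟩]
  have memH : ∀ (cs : Fin m → Fin (2 * n)) (B : Finset (Fin 2 × Fin m × Fin n)),
      hdet K (setH m n hn cs) B ∈ RingHom.ker φ := by
    intro cs B
    refine hdet_mem_H φ w hw kH' _ _ (fun i => ?_) fun s hs s' hs' h =>
      setH_inj hn cs s hs s' hs' (congrArg Fin.val h)
    exact ⟨_, Finset.mem_image_of_mem _ (Finset.mem_univ i), rfl⟩
  have memV : ∀ (rs : Fin n → Fin (2 * m)) (A : Finset (Fin 2 × Fin m × Fin n)),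
      hdet K A (setV m n hm rs) ∈ RingHom.ker ψ := by
    intro rs A
    refine hdet_mem_V ψ w' hw' kV' _ _ (fun i => ?_) fun s hs s' hs' h =>
      setV_inj hm rs s hs s' hs' (congrArg Fin.val h)
    exact ⟨_, Finset.mem_image_of_mem _ (Finset.mem_univ i), rfl⟩
  have leadH : ∀ f ∈ RingHom.ker φ, ∀ μ, IsLeadMono (tord0 m n) f μ → ∃ a ∈ LH m n hn, a ≤ μ := by
    refine lead_of_std (tord0 m n) _ _ ?_ ?_
    · rintro a ⟨cs, hcs, rfl⟩
      refine ⟨_, memH cs ∅, ?_⟩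
      have := hdet_lead K (good_H hn cs hcs)
      rw [sum_setH]
      simpa using this
    · intro f hf h
      by_contra h0
      obtain ⟨μ, hμ, cs, hcs, hpos⟩ := hφ f h0 hf
      refine h μ hμ _ ⟨cs, hcs, rfl⟩ ?_
      rw [sum_setH]
      refine sum_single_le _ _ fun s hs => ?_
      obtain ⟨i, -, rfl⟩ := Finset.mem_image.1 hs
      exact hpos i
  have leadV : ∀ f ∈ RingHom.ker ψ, ∀ μ, IsLeadMono (tord0 m n) f μ → ∃ a ∈ LV m n hm, a ≤ μ := by
    refine lead_of_std (tord0 m n) _ _ ?_ ?_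
    · rintro a ⟨cs, hcs, rfl⟩
      refine ⟨_, memV cs ∅, ?_⟩
      have := hdet_lead K (good_V hm cs hcs)
      rw [sum_setV]
      simpa using this
    · intro f hf h
      by_contra h0
      obtain ⟨μ, hμ, cs, hcs, hpos⟩ := hψ f h0 hf
      refine h μ hμ _ ⟨cs, hcs, rfl⟩ ?_
      rw [sum_setV]
      refine sum_single_le _ _ fun s hs => ?_
      obtain ⟨i, -, rfl⟩ := Finset.mem_image.1 hs
      exact hpos i
  have hsum : F ∈ RingHom.ker φ ⊔ RingHom.ker ψ := by
    have hle : doubleDetIdeal K 2 m n m n hm hn ≤ RingHom.ker φ ⊔ RingHom.ker ψ := by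
      rw [doubleDetIdeal, Ideal.span_le]
      rintro d (⟨rs, cs, hrs, hcs, rfl⟩ | ⟨rs, cs, hrs, hcs, rfl⟩)
      · refine Ideal.mem_sup_left ?_
        rw [strictMono_fin_id rs hrs, RingHom.mem_ker, RingHom.map_det,
          ← Matrix.exists_vecMul_eq_zero_iff]
        refine ⟨w, fun h => ?_, ?_⟩
        · obtain ⟨i, hi⟩ := hw
          exact hi (congrFun h i)
        · ext1 k
          exact hker (cs k)
      · refine Ideal.mem_sup_right ?_
        rw [strictMono_fin_id cs hcs, RingHom.mem_ker, RingHom.map_det,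
          ← Matrix.exists_mulVec_eq_zero_iff]
        refine ⟨w', fun h => ?_, ?_⟩
        · obtain ⟨i, hi⟩ := hw'
          exact hi (congrFun h i)
        · ext1 k
          refine Eq.trans ?_ (hker' (rs k))
          rw [Matrix.mulVec, dotProduct]
          exact Finset.sum_congr rfl fun j _ => mul_comm (ψ (X (varV 2 m n hm (rs k) j))) (w' j)
    exact hle hF
  by_contra h0
  obtain ⟨μ, hμ⟩ := exists_lead (tord0 m n) F h0
  obtain ⟨a, ha, hle⟩ := lead_of_sum (tord0 m n) _ _ _ _ leadH leadV (by
    rintro a ⟨cs, hcs, rfl⟩ b ⟨rs, hrs, rfl⟩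
    refine ⟨_, memH cs (setV m n hm rs), memV rs _, ?_⟩
    rw [sum_setH, sum_setV]
    exact hdet_empty_mono _ _ (good_HV hm hn cs hcs rs hrs)) F hsum μ hμ
  exact hstd μ hμ.1 a ha hle

end Final

theorem two_matrix_maximal_minors_groebner (K : Type*) [Field K] (m n : ℕ)
    (hm : 0 < m) (hn : 0 < n)
    (tord : TermOrder (Fin 2 × Fin m × Fin n))
    (hdiag : IsDiagonalTermOrder K 2 m n hm hn tord) :
    IsGroebnerBasis tord (doubleDetIdeal K 2 m n m n hm hn)
      (minorsSet m m (2 * n) (Hmat K 2 m n hn) ∪ minorsSet n (2 * m) n (Vmat K 2 m n hm)) := by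
  have hlead : ∀ a ∈ LH m n hn ∪ LV m n hm,
      ∃ g ∈ minorsSet m m (2 * n) (Hmat K 2 m n hn) ∪ minorsSet n (2 * m) n (Vmat K 2 m n hm),
        IsLeadMono tord g a := by
    rintro a (⟨cs, hcs, rfl⟩ | ⟨rs, hrs, rfl⟩)
    · exact ⟨_, Or.inl ⟨id, cs, strictMono_id, hcs, rfl⟩, hdiag.1 m id cs strictMono_id hcs hm⟩
    · exact ⟨_, Or.inr ⟨rs, id, hrs, strictMono_id, rfl⟩, hdiag.2 n rs id hrs strictMono_id hn⟩
  refine ⟨Ideal.subset_span, rfl, le_antisymm ?_ ?_⟩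
  · rw [initialIdeal, Ideal.span_le]
    rintro g ⟨f, hf, μ, hμ, rfl⟩
    obtain ⟨a, ha, hle⟩ := lead_of_std tord (doubleDetIdeal K 2 m n m n hm hn)
      (LH m n hn ∪ LV m n hm)
      (fun a ha => by
        obtain ⟨g, hg, hga⟩ := hlead a ha
        exact ⟨g, Ideal.subset_span hg, hga⟩)
      (fun F hF h => std_zero hm hn F hF h) f hf μ hμ
    obtain ⟨g, hg, hga⟩ := hlead a ha
    have : (monomial μ (1 : K)) = monomial (μ - a) 1 * monomial a 1 := by
      rw [monomial_mul, tsub_add_cancel_of_le hle, mul_one]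
    rw [this]
    exact Ideal.mul_mem_left _ _ (Ideal.subset_span ⟨g, hg, a, hga, rfl⟩)
  · refine Ideal.span_mono ?_
    rintro g ⟨f, hf, μ, hμ, rfl⟩
    exact ⟨f, Ideal.subset_span hf, μ, hμ, rfl⟩

end
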